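/- For every partition λ with at most n parts, every coefficient of the interpolation Macdonald polynomial P*_λ, viewed as a rational function of q and t, is regular at q = 1, and the specialization at q = 1 factorizes as P*_λ(x_1,…,x_n;1,t) = ∏_{i=1}^{λ_1} e*_{λ'_i}(x_1,…,x_n;t), where λ' is the conjugate partition of λ. -/

import Mathlib

open MvPolynomial

noncomputable section
open scoped Classical

/-- The field `K = ℚ(q,t)`. -/
abbrev K : Type := FractionRing (MvPolynomial (Fin 2) ℚ)

/-- The indeterminate `q` as an element of `K`. -/
def qq : K := algebraMap (MvPolynomial (Fin 2) ℚ) K (X 0)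

/-- The indeterminate `t` as an element of `K`. -/
def tt : K := algebraMap (MvPolynomial (Fin 2) ℚ) K (X 1)

/-- The size `|ν|` of a composition. -/
def csize {n : ℕ} (ν : Fin n → ℕ) : ℕ := ∑ i, ν i

/-- `k_i(ν) = #{j < i : ν_j > ν_i} + #{j > i : ν_j ≥ ν_i}`. -/
def kstat {n : ℕ} (ν : Fin n → ℕ) (i : Fin n) : ℕ :=
  Set.ncard {j : Fin n | j < i ∧ ν i < ν j} + Set.ncard {j : Fin n | i < j ∧ ν i ≤ ν j}

/-- The evaluation point `ν̃ = (q^{ν_i} t^{-k_i(ν)})_i`. -/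
def evalPt {n : ℕ} (ν : Fin n → ℕ) : Fin n → K :=
  fun i => qq ^ ν i * tt ^ (-(kstat ν i : ℤ))

/-- Weakly decreasing composition. -/
def IsPartition {n : ℕ} (l : Fin n → ℕ) : Prop := ∀ i j : Fin n, i ≤ j → l j ≤ l i

/-- The action `σ·μ := μ ∘ σ⁻¹`. -/
def permAct {n : ℕ} (σ : Equiv.Perm (Fin n)) (μ : Fin n → ℕ) : Fin n → ℕ := μ ∘ ⇑σ.symm

/-- `S_n(λ)`: the rearrangements of `λ`. -/
def Sn {n : ℕ} (l : Fin n → ℕ) : Set (Fin n → ℕ) :=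
  {μ | ∃ σ : Equiv.Perm (Fin n), permAct σ l = μ}

/-- The rearrangements of `λ` as a `Finset`. -/
def SnFinset {n : ℕ} (l : Fin n → ℕ) : Finset (Fin n → ℕ) :=
  Finset.image (fun σ : Equiv.Perm (Fin n) => permAct σ l) Finset.univ

/-- The exponent `Finsupp` of the monomial `x^μ`. -/
def expOf {n : ℕ} (μ : Fin n → ℕ) : Fin n →₀ ℕ := Finsupp.equivFunOnFinite.symm μ

/-- Characterization of the interpolation nonsymmetric Macdonald polynomial `E*_μ`. -/
def IsEstar {n : ℕ} (μ : Fin n → ℕ) (f : MvPolynomial (Fin n) K) : Prop :=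
  f.totalDegree ≤ csize μ ∧ coeff (expOf μ) f = 1 ∧
    ∀ ν : Fin n → ℕ, csize ν ≤ csize μ → ν ≠ μ → eval (evalPt ν) f = 0

/-- The interpolation nonsymmetric Macdonald polynomial `E*_μ` (unique by Knop–Sahi). -/
def Estar {n : ℕ} (μ : Fin n → ℕ) : MvPolynomial (Fin n) K :=
  if h : ∃ f, IsEstar μ f then h.choose else 0

/-- Characterization of the interpolation (symmetric) Macdonald polynomial `P*_λ`. -/
def IsPstar {n : ℕ} (l : Fin n → ℕ) (f : MvPolynomial (Fin n) K) : Prop :=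
  f.IsSymmetric ∧ f.totalDegree ≤ csize l ∧ coeff (expOf l) f = 1 ∧
    ∀ ν : Fin n → ℕ, IsPartition ν → csize ν ≤ csize l → ν ≠ l → eval (evalPt ν) f = 0

/-- The interpolation Macdonald polynomial `P*_λ`. -/
def Pstar {n : ℕ} (l : Fin n → ℕ) : MvPolynomial (Fin n) K :=
  if h : ∃ f, IsPstar l f then h.choose else 0

/-- The space `V*_λ`. -/
def Vstar {n : ℕ} (l : Fin n → ℕ) : Submodule K (MvPolynomial (Fin n) K) :=
  (restrictTotalDegree (Fin n) K (csize l)) ⊓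
    ⨅ (ν : Fin n → ℕ) (_ : csize ν ≤ csize l ∧ ν ∉ Sn l),
      LinearMap.ker (aeval (R := K) (evalPt ν)).toLinearMap

/-- Exchange of the variables `x_i` and `x_j` in a polynomial. -/
def swapVars {n : ℕ} (i j : Fin n) (f : MvPolynomial (Fin n) K) : MvPolynomial (Fin n) K :=
  rename (Equiv.swap i j) f

/-- Exact division of polynomials: the unique `g` with `a = b * g` when it exists. -/
def exactDiv {n : ℕ} (a b : MvPolynomial (Fin n) K) : MvPolynomial (Fin n) K :=
  if h : ∃ g, a = b * g then h.choose else 0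

/-- The Hecke operator
`T f = t f − ((t x_i − x_j)/(x_i − x_j))·(f − s_i f)` (where `j = i+1`). -/
def hecke {n : ℕ} (i j : Fin n) (f : MvPolynomial (Fin n) K) : MvPolynomial (Fin n) K :=
  C tt * f - (C tt * X i - X j) * exactDiv (f - swapVars i j f) (X i - X j)

/-- The Coxeter length of a permutation (number of inversions). -/
def permLength {n : ℕ} (σ : Equiv.Perm (Fin n)) : ℕ :=
  Set.ncard {p : Fin n × Fin n | p.1 < p.2 ∧ σ p.2 < σ p.1}

/-- The adjacent transposition `s_i = (i, i+1)` (0-indexed). -/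
def adjSwap {n : ℕ} (i : {i : ℕ // i + 1 < n}) : Equiv.Perm (Fin n) :=
  Equiv.swap ⟨i.1, Nat.lt_of_succ_lt i.2⟩ ⟨i.1 + 1, i.2⟩

/-- The Hecke operator `T_i` for an adjacent transposition index. -/
def heckeAt {n : ℕ} (i : {i : ℕ // i + 1 < n}) :
    MvPolynomial (Fin n) K → MvPolynomial (Fin n) K :=
  hecke ⟨i.1, Nat.lt_of_succ_lt i.2⟩ ⟨i.1 + 1, i.2⟩

/-- `T_{i_1} ⋯ T_{i_ℓ} f` for a word `w = [i_1, …, i_ℓ]`. -/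
def Tword {n : ℕ} (w : List {i : ℕ // i + 1 < n}) (f : MvPolynomial (Fin n) K) :
    MvPolynomial (Fin n) K :=
  w.foldr heckeAt f

/-- `w` is a reduced word for `σ`. -/
def IsReducedWordOf {n : ℕ} (w : List {i : ℕ // i + 1 < n}) (σ : Equiv.Perm (Fin n)) : Prop :=
  (w.map adjSwap).prod = σ ∧ w.length = permLength σ

/-- `T_σ`, computed from a reduced word of `σ` (independent of the choice, by the
Hecke algebra relations). -/
def Tsigma {n : ℕ} (σ : Equiv.Perm (Fin n)) :
    MvPolynomial (Fin n) K → MvPolynomial (Fin n) K :=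
  if h : ∃ w, IsReducedWordOf w σ then Tword h.choose else id

/-- `σ_μ`: the (unique) shortest permutation with `σ·l = μ`. -/
def sigmaMin {n : ℕ} (l μ : Fin n → ℕ) : Equiv.Perm (Fin n) :=
  if h : ∃ σ, permAct σ l = μ ∧ ∀ τ, permAct τ l = μ → permLength σ ≤ permLength τ then
    h.choose else 1

/-- The weakly decreasing rearrangement of a composition. -/
def sortDesc {n : ℕ} (μ : Fin n → ℕ) : Fin n → ℕ :=
  if h : ∃ l, IsPartition l ∧ μ ∈ Sn l then h.choose else μ

/-- The interpolation ASEP polynomial `f*_μ = T_{σ_μ} E*_λ`, where `λ` is the weakly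
decreasing rearrangement of `μ`. -/
def fstar {n : ℕ} (μ : Fin n → ℕ) : MvPolynomial (Fin n) K :=
  Tsigma (sigmaMin (sortDesc μ) μ) (Estar (sortDesc μ))

/-- The composition with entries `i` and `j` exchanged. -/
def swapEntries {n : ℕ} (i j : Fin n) (μ : Fin n → ℕ) : Fin n → ℕ := μ ∘ ⇑(Equiv.swap i j)
/-- The field `K1 = ℚ(t)`. -/
abbrev K1 : Type := FractionRing (Polynomial ℚ)

/-- The indeterminate `t` as an element of `K1`. -/
def t1 : K1 := algebraMap (Polynomial ℚ) K1 Polynomial.X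

/-- Specialization `q = 1` on `ℚ[q,t]`, landing in `ℚ(t)`. -/
def specQ1 : MvPolynomial (Fin 2) ℚ →+* K1 :=
  (MvPolynomial.aeval (fun i : Fin 2 => if i = 0 then (1 : K1) else t1)).toRingHom

/-- `c ∈ K = ℚ(q,t)` is regular at `q = 1` with value `v ∈ ℚ(t)`. -/
def RegAtQ1 (c : K) (v : K1) : Prop :=
  ∃ a b : MvPolynomial (Fin 2) ℚ, b ≠ 0 ∧ specQ1 b ≠ 0 ∧
    c = algebraMap (MvPolynomial (Fin 2) ℚ) K a / algebraMap (MvPolynomial (Fin 2) ℚ) K b ∧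
    v = specQ1 a / specQ1 b

/-- The inhomogeneous elementary symmetric polynomial `e*_k(x_1,…,x_n;t)`, over `ℚ(t)`. -/
def estarElem1 (n k : ℕ) : MvPolynomial (Fin n) K1 :=
  ∑ S ∈ Finset.powersetCard k (Finset.univ : Finset (Fin n)),
    ∏ i ∈ S,
      (X i - C (t1 ^ (Finset.univ.filter (fun j : Fin n => j < i ∧ j ∉ S)).card
        / t1 ^ (n - 1)))

/-- `λ'_m = #{i : λ_i ≥ m}`, the parts of the conjugate partition. -/
def conjPart {n : ℕ} (l : Fin n → ℕ) (m : ℕ) : ℕ :=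
  (Finset.univ.filter (fun i : Fin n => m ≤ l i)).card

/-! ### Part A : factorial elementary symmetric functions -/

/-- recursive factorial elementary symmetric function -/
def facE {A : Type*} [CommRing A] (a x : ℕ → A) : ℕ → ℕ → A
  | _, 0 => 1
  | 0, _ + 1 => 0
  | n + 1, k + 1 => facE a x n (k + 1) + (x n - a (n - k)) * facE a x n k

/-- complete homogeneous functions `h_r(a_0,…,a_{m-1})` -/
def facH {A : Type*} [CommRing A] (a : ℕ → A) : ℕ → ℕ → A
  | 0, _ => 1
  | _ + 1, 0 => 0
  | r + 1, m + 1 => facH a (r + 1) m + a m * facH a r (m + 1)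
termination_by r m => r + m

theorem facE_gt {A : Type*} [CommRing A] (a x : ℕ → A) (n k : ℕ) (h : n < k) :
    facE a x n k = 0 := by
  induction n generalizing k with
  | zero => cases k with
    | zero => omega
    | succ k => simp [facE]
  | succ n ih => cases k with
    | zero => omega
    | succ k => simp only [facE]; rw [ih (k+1) (by omega), ih k (by omega)]; ring

theorem facE_zero {A : Type*} [CommRing A] (a x : ℕ → A) (n : ℕ) : facE a x n 0 = 1 := by
  cases n <;> simp [facE]

theorem facE_eq_sum {A : Type*} [CommRing A] (a x : ℕ → A) (n k : ℕ) :
    facE a x n k = ∑ S ∈ Finset.powersetCard k (Finset.range n),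
      ∏ i ∈ S, (x i - a ((Finset.range i).filter (fun j => j ∉ S)).card) := by
  induction n generalizing k with
  | zero => cases k with
    | zero => simp [facE]
    | succ k =>
      rw [facE, Finset.powersetCard_eq_empty.2 (by simp)]; simp
  | succ n ih => cases k with
    | zero => simp [facE]
    | succ k =>
      simp only [facE]
      rw [Finset.range_add_one, Finset.powersetCard_succ_insert (by simp)]
      rw [Finset.sum_union, ← ih, Finset.sum_image, ih k, Finset.mul_sum]
      · congr 1
        refine Finset.sum_congr rfl fun S hS => ?_
        rw [Finset.mem_powersetCard] at hS
        have hn : n ∉ S := fun h => by simpa using hS.1 h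
        rw [Finset.prod_insert hn]
        congr 1
        · congr 2
          have : (Finset.range n).filter (fun j => j ∉ insert n S) = Finset.range n \ S := by
            ext j; simp only [Finset.mem_filter, Finset.mem_range, Finset.mem_insert, Finset.mem_sdiff]
            constructor
            · rintro ⟨h1, h2⟩; exact ⟨h1, fun h => h2 (Or.inr h)⟩
            · rintro ⟨h1, h2⟩; exact ⟨h1, fun h => h.elim (by omega) h2⟩
          rw [this, Finset.card_sdiff_of_subset hS.1, hS.2, Finset.card_range]
        · refine Finset.prod_congr rfl fun i hi => ?_
          have hi' : i < n := by simpa using hS.1 hi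
          congr 3
          ext j; simp only [Finset.mem_filter, Finset.mem_range, Finset.mem_insert]
          constructor
          · rintro ⟨h1, h2⟩; exact ⟨h1, fun h => h.elim (by omega) h2⟩
          · rintro ⟨h1, h2⟩; exact ⟨h1, fun h => h2 (Or.inr h)⟩
      · intro S hS T hT h
        have hS' := Finset.mem_powersetCard.1 hS
        have hT' := Finset.mem_powersetCard.1 hT
        have hn : n ∉ S := fun h => by simpa using hS'.1 h
        have hn' : n ∉ T := fun h => by simpa using hT'.1 h
        rw [← Finset.erase_insert hn, ← Finset.erase_insert hn', h]
      · rw [Finset.disjoint_left]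
        intro S hS hS2
        obtain ⟨T, hT, rfl⟩ := Finset.mem_image.1 hS2
        have := (Finset.mem_powersetCard.1 hS).1 (Finset.mem_insert_self n T)
        simp at this

/-- expansion in ordinary elementary symmetric functions -/
theorem facE_expand {A : Type*} [CommRing A] (a x : ℕ → A) (n k : ℕ) (h : k ≤ n + 1) :
    facE a x n k = ∑ j ∈ Finset.range (k + 1),
      (-1) ^ (k - j) * facH a (k - j) (n + 1 - k) * facE (fun _ => 0) x n j := by
  induction n generalizing k with
  | zero =>
    rcases k with _ | k
    · simp [facE, facH]
    · obtain rfl : k = 0 := by omega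
      simp [Finset.sum_range_succ, facE, facH]
  | succ n ih =>
    rcases k with _ | k
    · simp [facE, facH]
    · rcases Nat.lt_or_ge n k with hk | hk
      · obtain rfl : k = n + 1 := by omega
        rw [facE_gt _ _ _ _ (by omega), Finset.sum_range_succ, facE_gt _ _ _ _ (by omega), mul_zero,
          add_zero]
        symm
        apply Finset.sum_eq_zero
        intro j hj
        rw [Finset.mem_range] at hj
        obtain ⟨r, hr⟩ : ∃ r, n + 1 + 1 - j = r + 1 := ⟨n + 1 - j, by omega⟩
        rw [hr]; simp [facH]
      · simp only [facE]
        rw [ih (k+1) (by omega), ih k (by omega)]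
        obtain ⟨m, rfl⟩ := Nat.exists_eq_add_of_le hk
        have e1 : k + m + 1 - (k + 1) = m := by omega
        have e2 : k + m - k = m := by omega
        have e3 : k + m + 1 - k = m + 1 := by omega
        have e4 : k + m + 1 + 1 - (k + 1) = m + 1 := by omega
        rw [e1, e2, e3, e4]
        -- RHS expand
        have key : ∀ j ∈ Finset.range (k + 1 + 1), 
            (-1 : A) ^ (k + 1 - j) * facH a (k + 1 - j) (m + 1) * facE (fun _ => 0) x (k + m + 1) j
            = (-1 : A) ^ (k + 1 - j) * facH a (k + 1 - j) (m + 1) * facE (fun _ => 0) x (k + m) j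
            + (if j = 0 then 0 else (-1 : A) ^ (k + 1 - j) * facH a (k + 1 - j) (m + 1) * 
                (x (k + m) * facE (fun _ => 0) x (k + m) (j - 1))) := by
          intro j _
          rcases j with _ | j
          · simp [facE_zero]
          · simp [facE]; ring
        rw [Finset.sum_congr rfl key, Finset.sum_add_distrib, Finset.sum_range_succ' (fun j => if j = 0 then _ else _)]
        simp only [Nat.add_sub_add_right, Nat.add_sub_cancel, if_true, Nat.succ_ne_zero, if_false, add_zero]
        rw [sub_mul, Finset.mul_sum, add_sub_left_comm, add_comm]
        have e5 : ∀ j, x (k+m) * ((-1 : A)^(k-j) * facH a (k-j) (m+1) * facE (fun _ => 0) x (k+m) j)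
          = (-1 : A)^(k-j) * facH a (k-j) (m+1) * (x (k+m) * facE (fun _ => 0) x (k+m) j) := by
          intro j; ring
        simp only [e5]
        congr 1
        rw [Finset.sum_range_succ, Finset.sum_range_succ _ (k+1), Finset.mul_sum]
        simp only [Nat.sub_self, facH]
        rw [add_sub_right_comm, ← Finset.sum_sub_distrib]
        congr 1
        refine Finset.sum_congr rfl fun j hj => ?_
        rw [Finset.mem_range] at hj
        obtain ⟨r, hr⟩ : ∃ r, k = j + r := Nat.exists_eq_add_of_le (by omega)
        subst hr
        have e6 : j + r + 1 - j = r + 1 := by omega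
        have e7 : j + r - j = r := by omega
        rw [e6, e7]
        simp only [facH]
        ring

/-- evaluation: vanishing prefix -/
theorem facE_prefix {A : Type*} [CommRing A] (a x : ℕ → A) (n k : ℕ) (h : k ≤ n)
    (hx : ∀ i, i < n - k → x i = a i) :
    facE a x n k = ∏ i ∈ Finset.Ico (n - k) n, (x i - a (n - k)) := by
  induction n generalizing k with
  | zero => obtain rfl : k = 0 := by omega
            simp [facE]
  | succ n ih =>
    rcases k with _ | k
    · simp [facE]
    · simp only [facE]
      rw [Nat.add_sub_add_right] at hx ⊢
      rw [ih k (by omega) hx, Finset.prod_Ico_succ_top (by omega)]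
      rcases Nat.lt_or_ge k n with hk | hk
      · rw [ih (k+1) (by omega) (fun i hi => hx i (by omega))]
        have : ∏ i ∈ Finset.Ico (n - (k+1)) n, (x i - a (n - (k+1))) = 0 := by
          apply Finset.prod_eq_zero (i := n - (k+1)) (by simp; omega)
          rw [hx _ (by omega), sub_self]
        rw [this]; ring
      · rw [facE_gt _ _ _ _ (by omega)]; ring

theorem facE_map {A B : Type*} [CommRing A] [CommRing B] (φ : A →+* B) (a x : ℕ → A) (n k : ℕ) :
    φ (facE a x n k) = facE (fun i => φ (a i)) (fun i => φ (x i)) n k := by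
  induction n generalizing k with
  | zero => cases k <;> simp [facE]
  | succ n ih => cases k with
    | zero => simp [facE]
    | succ k => simp [facE, ih]

theorem facE_congr {A : Type*} [CommRing A] (a x y : ℕ → A) (n k : ℕ) (h : ∀ i < n, x i = y i) :
    facE a x n k = facE a y n k := by
  induction n generalizing k with
  | zero => cases k <;> simp [facE]
  | succ n ih => cases k with
    | zero => simp [facE]
    | succ k => 
      simp only [facE]; rw [ih _ (fun i hi => h i (by omega)), ih _ (fun i hi => h i (by omega)), h n (by omega)]


/-- the variables, extended by zero to all of `ℕ` -/
def xvar (n : ℕ) (R : Type*) [CommRing R] (i : ℕ) : MvPolynomial (Fin n) R :=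
  if h : i < n then X ⟨i, h⟩ else 0

/-- the factorial elementary symmetric polynomial in `n` variables -/
def facP (n k : ℕ) {R : Type*} [CommRing R] (a : ℕ → R) : MvPolynomial (Fin n) R :=
  facE (fun i => C (a i)) (xvar n R) n k

theorem facP_eq_sum (n k : ℕ) {R : Type*} [CommRing R] (a : ℕ → R) :
    facP n k a = ∑ S ∈ Finset.powersetCard k (Finset.univ : Finset (Fin n)),
      ∏ i ∈ S, (X i - C (a (Finset.univ.filter (fun j : Fin n => j < i ∧ j ∉ S)).card)) := by
  rw [facP, facE_eq_sum]
  have h1 : Finset.range n = (Finset.univ : Finset (Fin n)).map Fin.valEmbedding := by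
    ext i; simp only [Finset.mem_range, Finset.mem_map, Finset.mem_univ, true_and, Fin.valEmbedding_apply]
    exact ⟨fun h => ⟨⟨i, h⟩, rfl⟩, fun ⟨j, hj⟩ => hj ▸ j.2⟩
  rw [h1, Finset.powersetCard_map, Finset.sum_map]
  refine Finset.sum_congr rfl fun S hS => ?_
  rw [RelEmbedding.coe_toEmbedding, Finset.mapEmbedding_apply, Finset.prod_map]
  refine Finset.prod_congr rfl fun i hi => ?_
  have h2 : ((Finset.range (Fin.valEmbedding i)).filter (fun j => j ∉ S.map Fin.valEmbedding)).card
    = (Finset.univ.filter (fun j : Fin n => j < i ∧ j ∉ S)).card := by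
    rw [← Finset.card_map Fin.valEmbedding]
    congr 1
    ext j
    simp only [Finset.mem_filter, Finset.mem_range, Finset.mem_map, Fin.valEmbedding_apply,
      Finset.mem_univ, true_and]
    constructor
    · rintro ⟨h1, h2⟩
      exact ⟨⟨j, h1.trans i.2⟩, ⟨h1, fun h => h2 ⟨_, h, rfl⟩⟩, rfl⟩
    · rintro ⟨k, ⟨h1, h2⟩, rfl⟩
      refine ⟨h1, ?_⟩
      rintro ⟨m, hm, hm2⟩
      exact h2 (Fin.ext hm2 ▸ hm)
  rw [h2]
  simp [xvar]

theorem facP_zero_eq_esymm (n k : ℕ) (R : Type*) [CommRing R] :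
    facP n k (fun _ => (0 : R)) = esymm (Fin n) R k := by
  rw [facP_eq_sum, esymm]
  simp

theorem facP_expand (n k : ℕ) (hk : k ≤ n) {R : Type*} [CommRing R] (a : ℕ → R) :
    facP n k a = ∑ j ∈ Finset.range (k + 1),
      C ((-1) ^ (k - j) * facH a (k - j) (n + 1 - k)) * esymm (Fin n) R j := by
  rw [facP, facE_expand _ _ _ _ (by omega)]
  refine Finset.sum_congr rfl fun j hj => ?_
  rw [← facP_zero_eq_esymm, facP]
  have h : ∀ r m, facH (fun i => (C (a i) : MvPolynomial (Fin n) R)) r m = C (facH a r m) := by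
    intro r m
    induction hs : r + m using Nat.strong_induction_on generalizing r m with
    | _ s ih =>
      rcases r with _ | r
      · simp [facH]
      · rcases m with _ | m
        · simp [facH]
        · simp only [facH]
          rw [ih (r + 1 + m) (by omega) _ _ rfl, ih (r + (m+1)) (by omega) _ _ rfl]; simp
  rw [h]; simp

theorem facP_symm (n k : ℕ) (hk : k ≤ n) {R : Type*} [CommRing R] (a : ℕ → R) :
    (facP n k a).IsSymmetric := by
  rw [facP_expand n k hk, ← mem_symmetricSubalgebra]
  refine Subalgebra.sum_mem _ fun j _ => Subalgebra.mul_mem _ ?_ ?_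
  · exact IsSymmetric.C _
  · exact esymm_isSymmetric _ _ _

theorem facP_totalDegree (n k : ℕ) {R : Type*} [CommRing R] (a : ℕ → R) :
    (facP n k a).totalDegree ≤ k := by
  rw [facP_eq_sum]
  refine totalDegree_finsetSum_le fun S hS => ?_
  refine (totalDegree_finsetProd _ _).trans ?_
  rw [← (Finset.mem_powersetCard.1 hS).2, Finset.card_eq_sum_ones]
  refine Finset.sum_le_sum fun i _ => ?_
  refine (totalDegree_sub_C_le _ _).trans ?_
  rcases subsingleton_or_nontrivial R with h | h
  · rw [Subsingleton.elim (X i : MvPolynomial (Fin n) R) 0]; simp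
  · simp

theorem facP_map (n k : ℕ) {R S : Type*} [CommRing R] [CommRing S] (φ : R →+* S) (a : ℕ → R) :
    map φ (facP n k a) = facP n k (fun i => φ (a i)) := by
  rw [facP, facE_map, facP]
  congr 1
  · simp
  · funext i; simp only [xvar]; split_ifs <;> simp

theorem facP_eval (n k : ℕ) {R : Type*} [CommRing R] (a : ℕ → R) (x : ℕ → R) :
    eval (fun i : Fin n => x i) (facP n k a) = facE a x n k := by
  rw [facP, facE_map]
  simp only [eval_C]
  apply facE_congr
  intro i hi
  simp [xvar, hi]

theorem eval_symm {n : ℕ} {R : Type*} [CommRing R] {f : MvPolynomial (Fin n) R} (hf : f.IsSymmetric)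
    (x : Fin n → R) (σ : Equiv.Perm (Fin n)) : eval (x ∘ σ) f = eval x f := by
  conv_rhs => rw [← hf σ]
  rw [eval_rename]

/-- evaluation at points whose tail equals the (reversed) parameters -/
theorem facP_eval_tail (n k : ℕ) (hk : k ≤ n) {R : Type*} [CommRing R] (a : ℕ → R) (x : ℕ → R)
    (hx : ∀ i, k ≤ i → i < n → x i = a (n - 1 - i)) :
    eval (fun i : Fin n => x i) (facP n k a) = ∏ i ∈ Finset.range k, (x i - a (n - k)) := by
  rw [← eval_symm (facP_symm n k hk a) _ Fin.revPerm]
  have : (fun i : Fin n => x i) ∘ (Fin.revPerm : Equiv.Perm (Fin n))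
      = fun i : Fin n => (fun j => x (n - 1 - j)) (i : ℕ) := by
    funext i; simp [Fin.val_rev]; congr 1; omega
  rw [this, facP_eval n k a (fun j => x (n - 1 - j)), facE_prefix _ _ _ _ hk]
  · refine Finset.prod_bij' (fun i _ => n - 1 - i) (fun i _ => n - 1 - i) ?_ ?_ ?_ ?_ ?_
    all_goals intro i hi; simp only [Finset.mem_Ico, Finset.mem_range] at hi ⊢; try omega
  · intro i hi
    rw [hx _ (by omega) (by omega)]; congr 1; omega

/-! ### Part B : evaluation points, nondegeneracy of interpolation -/

theorem tt_ne : tt ≠ 0 := by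
  rw [tt, Ne, FaithfulSMul.algebraMap_eq_zero_iff]; exact X_ne_zero _
theorem qq_ne : qq ≠ 0 := by
  rw [qq, Ne, FaithfulSMul.algebraMap_eq_zero_iff]; exact X_ne_zero _

theorem qt_inj {a b i j : ℕ} (h : qq ^ a * tt⁻¹ ^ i = qq ^ b * tt⁻¹ ^ j) : a = b ∧ i = j := by
  have h1 : qq ^ a * tt ^ j = qq ^ b * tt ^ i := by
    have hi : tt ^ i ≠ 0 := pow_ne_zero _ tt_ne
    have hj : tt ^ j ≠ 0 := pow_ne_zero _ tt_ne
    rw [inv_pow, inv_pow, ← div_eq_mul_inv, ← div_eq_mul_inv, div_eq_div_iff hi hj] at h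
    exact h
  rw [qq, tt, ← map_pow, ← map_pow, ← map_pow, ← map_pow, ← map_mul, ← map_mul] at h1
  have h2 := FaithfulSMul.algebraMap_injective _ _ h1
  rw [X_pow_eq_monomial, X_pow_eq_monomial, X_pow_eq_monomial, X_pow_eq_monomial, monomial_mul,
    monomial_mul] at h2
  have h3 := monomial_left_injective (by norm_num : (1 : ℚ) * 1 ≠ 0) h2
  have h4 := DFunLike.congr_fun h3 0
  have h5 := DFunLike.congr_fun h3 1
  simp at h4 h5
  exact ⟨h4, h5.symm⟩

/-- extension of a composition by zero -/
def cext {n : ℕ} (ν : Fin n → ℕ) (i : ℕ) : ℕ := if h : i < n then ν ⟨i, h⟩ else 0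

theorem cext_fin {n : ℕ} (ν : Fin n → ℕ) (i : Fin n) : cext ν i = ν i := by simp [cext]

theorem cext_anti {n : ℕ} {ν : Fin n → ℕ} (h : IsPartition ν) : Antitone (cext ν) := by
  intro i j hij
  unfold cext
  split_ifs with h1 h2 h2
  · exact h _ _ hij
  · omega
  · omega
  · omega

theorem csize_eq {n : ℕ} (ν : Fin n → ℕ) : csize ν = ∑ i ∈ Finset.range n, cext ν i := by
  rw [csize, Finset.sum_range]; simp [cext_fin]

/-- the points `q^{ν_i} t^{-i}` -/
def hpt {n : ℕ} (ν : Fin n → ℕ) (i : ℕ) : K := qq ^ cext ν i * tt⁻¹ ^ i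

theorem hpt_ne {n : ℕ} (ν : Fin n → ℕ) (i : ℕ) : hpt ν i ≠ 0 :=
  mul_ne_zero (pow_ne_zero _ qq_ne) (pow_ne_zero _ (inv_ne_zero tt_ne))

theorem hpt_inj {n : ℕ} (ν : Fin n → ℕ) : Function.Injective (hpt ν) := 
  fun _ _ h => (qt_inj h).2

/-- the permuted point -/
def hp {n : ℕ} (ν : Fin n → ℕ) : Fin n → K := fun i => hpt ν i

theorem kstat_eq {n : ℕ} (ν : Fin n → ℕ) (i : Fin n) :
    kstat ν i = (Finset.univ.filter (fun j : Fin n => ν i < ν j ∨ (ν i = ν j ∧ i < j))).card := by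
  rw [kstat, Set.ncard_eq_toFinset_card', Set.ncard_eq_toFinset_card', ← Finset.card_union_of_disjoint]
  · congr 1
    ext j
    simp only [Finset.mem_union, Set.mem_toFinset, Set.mem_ofPred_eq, Finset.mem_filter,
      Finset.mem_univ, true_and]
    rcases lt_trichotomy i j with h | h | h
    · simp only [h, not_lt_of_gt h, false_and, true_and, and_true, false_or]; omega
    · subst h; simp
    · simp only [h, not_lt_of_gt h, false_and, true_and, and_false, or_false]
  · rw [Finset.disjoint_left]
    intro j
    simp only [Set.mem_toFinset, Set.mem_ofPred_eq]
    rintro ⟨h1, _⟩ ⟨h2, _⟩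
    exact absurd h1 (not_lt_of_gt h2)

theorem kstat_lt {n : ℕ} (ν : Fin n → ℕ) (i : Fin n) : kstat ν i < n := by
  rw [kstat_eq]
  calc _ < (Finset.univ : Finset (Fin n)).card := by
        apply Finset.card_lt_card
        rw [Finset.ssubset_univ_iff]
        intro h
        have := Finset.mem_univ i
        rw [← h] at this
        simp at this
    _ = n := by simp

theorem kstat_mono {n : ℕ} (ν : Fin n → ℕ) (i j : Fin n) (h : ν i < ν j ∨ (ν i = ν j ∧ i < j)) :
    kstat ν j < kstat ν i := by
  rw [kstat_eq, kstat_eq]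
  apply Finset.card_lt_card
  rw [Finset.ssubset_iff_of_subset]
  · exact ⟨j, by simpa using h, by simp⟩
  · intro k
    simp only [Finset.mem_filter, Finset.mem_univ, true_and]
    intro hk
    omega

theorem kstat_inj {n : ℕ} (ν : Fin n → ℕ) : Function.Injective (fun i => (⟨kstat ν i, kstat_lt ν i⟩ : Fin n)) := by
  intro i j h
  simp only [Fin.mk.injEq] at h
  by_contra hne
  rcases lt_trichotomy (ν i) (ν j) with h1 | h1 | h1
  · have := kstat_mono ν i j (Or.inl h1); omega
  · rcases lt_or_gt_of_ne hne with h2 | h2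
    · have := kstat_mono ν i j (Or.inr ⟨h1, h2⟩); omega
    · have := kstat_mono ν j i (Or.inr ⟨h1.symm, h2⟩); omega
  · have := kstat_mono ν j i (Or.inl h1); omega

theorem evalPt_eq {n : ℕ} (ν : Fin n → ℕ) (hν : IsPartition ν) {f : MvPolynomial (Fin n) K}
    (hf : f.IsSymmetric) : eval (evalPt ν) f = eval (hp ν) f := by
  let σ : Equiv.Perm (Fin n) := Equiv.ofBijective _ (Finite.injective_iff_bijective.1 (kstat_inj ν))
  have hσ : ∀ i, ((σ i : Fin n) : ℕ) = kstat ν i := fun i => rfl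
  have h1 : ν ∘ σ.symm = ν := by
    have hA : Monotone ((fun i => OrderDual.toDual (ν i)) ∘ σ.symm) := by
      intro a b hab
      change ν (σ.symm b) ≤ ν (σ.symm a)
      by_contra hc
      push Not at hc
      have := kstat_mono ν _ _ (Or.inl hc)
      rw [← hσ, ← hσ] at this
      simp only [Equiv.apply_symm_apply] at this
      omega
    have hB : Monotone ((fun i => OrderDual.toDual (ν i)) ∘ (1 : Equiv.Perm (Fin n))) := by
      intro a b hab
      exact hν a b hab
    have := Tuple.unique_monotone hA hB
    funext i
    exact congrArg OrderDual.ofDual (congrFun this i)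
  have h2 : evalPt ν = hp ν ∘ σ := by
    funext i
    have : ν i = ν (σ i) := by
      have := congrFun h1 (σ i)
      simpa using this
    change qq ^ ν i * tt ^ (-(kstat ν i : ℤ)) = qq ^ cext ν (σ i) * tt⁻¹ ^ ((σ i : Fin n) : ℕ)
    rw [cext_fin, hσ, this, zpow_neg, inv_pow, zpow_natCast]
  rw [h2, eval_symm hf]

/-! #### test polynomials -/

/-- parameters for the test polynomials -/
def aseq {n : ℕ} (l : Fin n → ℕ) (r c : ℕ) (i : ℕ) : K :=
  if i < n - 1 - r then hpt l (n - 1 - i) else qq ^ c * tt⁻¹ ^ r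

def testP {n : ℕ} (l : Fin n → ℕ) : MvPolynomial (Fin n) K :=
  ∏ r ∈ Finset.range n, ∏ c ∈ Finset.Ico (cext l (r + 1)) (cext l r), facP n (r + 1) (aseq l r c)

theorem isSymm_prod {n : ℕ} {R ι : Type*} [CommRing R] (s : Finset ι) (f : ι → MvPolynomial (Fin n) R)
    (h : ∀ i ∈ s, (f i).IsSymmetric) : (∏ i ∈ s, f i).IsSymmetric := by
  rw [← mem_symmetricSubalgebra]
  exact Subalgebra.prod_mem _ fun i hi => h i hi

theorem testP_symm {n : ℕ} (l : Fin n → ℕ) : (testP l).IsSymmetric := by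
  apply isSymm_prod; intro r hr
  apply isSymm_prod; intro c hc
  apply facP_symm
  rw [Finset.mem_range] at hr; omega

theorem telescope (e : ℕ → ℕ) (he : Antitone e) (m : ℕ) :
    ∑ r ∈ Finset.range m, (e r - e (r + 1)) * (r + 1) + m * e m = ∑ r ∈ Finset.range m, e r := by
  induction m with
  | zero => simp
  | succ m ih =>
    rw [Finset.sum_range_succ, Finset.sum_range_succ, ← ih]
    obtain ⟨k, hk⟩ := Nat.exists_eq_add_of_le (he (Nat.le_succ m))
    rw [hk]; simp; ring

theorem testP_deg {n : ℕ} (l : Fin n → ℕ) (hl : IsPartition l) : (testP l).totalDegree ≤ csize l := by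
  rw [csize_eq, ← telescope _ (cext_anti hl)]
  refine le_trans ?_ (Nat.le_add_right _ _)
  refine (totalDegree_finsetProd _ _).trans (Finset.sum_le_sum fun r _ => ?_)
  refine (totalDegree_finsetProd _ _).trans ?_
  refine (Finset.sum_le_card_nsmul _ _ (r + 1) fun c _ => facP_totalDegree _ _ _).trans ?_
  simp

theorem testP_eval_factor {n : ℕ} (l ν : Fin n → ℕ) (r c : ℕ) (hr : r < n) 
    (h : ∀ i, r < i → i < n → cext ν i = cext l i) :
    eval (hp ν) (facP n (r + 1) (aseq l r c)) =
      ∏ i ∈ Finset.range (r + 1), (hpt ν i - qq ^ c * tt⁻¹ ^ r) := by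
  change eval (fun i : Fin n => hpt ν i) _ = _
  rw [facP_eval_tail n (r+1) (by omega)]
  · refine Finset.prod_congr rfl fun i _ => ?_
    rw [aseq, if_neg (by omega)]
  · intro i h1 h2
    rw [aseq, if_pos (by omega), hpt, hpt, h i (by omega) h2]
    have : n - 1 - (n - 1 - i) = i := by omega
    rw [this]

theorem testP_zero {n : ℕ} (l ν : Fin n → ℕ) (hν : IsPartition ν)
    (r : ℕ) (hr : r < n) (hlt : cext ν r < cext l r)
    (h : ∀ i, r < i → i < n → cext ν i = cext l i) : eval (hp ν) (testP l) = 0 := by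
  rw [testP, map_prod]
  apply Finset.prod_eq_zero (Finset.mem_range.2 hr)
  rw [map_prod]
  have hc : cext l (r + 1) ≤ cext ν r := by
    rcases Nat.lt_or_ge (r+1) n with h1 | h1
    · rw [← h _ (by omega) h1]; exact cext_anti hν (by omega)
    · simp [cext, Nat.not_lt.2 h1]
  apply Finset.prod_eq_zero (Finset.mem_Ico.2 ⟨hc, hlt⟩)
  rw [testP_eval_factor l ν r _ hr h]
  apply Finset.prod_eq_zero (Finset.mem_range.2 (Nat.lt_succ_self r))
  rw [hpt, sub_self]

theorem testP_ne {n : ℕ} (l : Fin n → ℕ) : eval (hp l) (testP l) ≠ 0 := by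
  rw [testP, map_prod, Finset.prod_ne_zero_iff]
  intro r hr
  rw [map_prod, Finset.prod_ne_zero_iff]
  intro c hc
  rw [Finset.mem_Ico] at hc
  rw [testP_eval_factor l l r c (Finset.mem_range.1 hr) (fun _ _ _ => rfl), Finset.prod_ne_zero_iff]
  intro i hi h0
  have := qt_inj (sub_eq_zero.1 h0)
  have h2 := this.2
  subst h2
  omega

/-- the index set of partitions of size at most `d` -/
abbrev PB (n d : ℕ) : Type := {ν : Fin n → ℕ // IsPartition ν ∧ csize ν ≤ d}

instance (n d : ℕ) : Finite (PB n d) := by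
  refine Set.Finite.subset (Set.finite_Iic (fun _ : Fin n => d)) ?_
  intro ν hν i
  exact (Finset.single_le_sum (fun _ _ => Nat.zero_le _) (Finset.mem_univ i)).trans hν.2

instance (n d : ℕ) : Fintype (PB n d) := Fintype.ofFinite _

/-- symmetric polynomials of degree at most `d` -/
def WS (n d : ℕ) : Submodule K (MvPolynomial (Fin n) K) :=
  Subalgebra.toSubmodule (symmetricSubalgebra (Fin n) K) ⊓ restrictTotalDegree (Fin n) K d

theorem mem_WS {n d : ℕ} {f : MvPolynomial (Fin n) K} :
    f ∈ WS n d ↔ f.IsSymmetric ∧ f.totalDegree ≤ d := by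
  rw [WS, Submodule.mem_inf, mem_restrictTotalDegree]; rfl

/-- coefficients at partitions -/
def coefMap (n d : ℕ) : WS n d →ₗ[K] (PB n d → K) :=
  LinearMap.pi fun ν => (lcoeff K (expOf ν.1)).comp (WS n d).subtype

/-- evaluations at partitions -/
def evMap (n d : ℕ) : WS n d →ₗ[K] (PB n d → K) :=
  LinearMap.pi fun ν => (aeval (R := K) (hp ν.1)).toLinearMap.comp (WS n d).subtype

theorem evMap_apply (n d : ℕ) (f : WS n d) (ν : PB n d) : evMap n d f ν = eval (hp ν.1) f.1 := by
  simp [evMap, aeval_eq_eval]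

theorem coeff_symm {n : ℕ} {R : Type*} [CommRing R] {f : MvPolynomial (Fin n) R} (hf : f.IsSymmetric)
    (m : Fin n → ℕ) (σ : Equiv.Perm (Fin n)) : coeff (expOf (m ∘ σ)) f = coeff (expOf m) f := by
  conv_rhs => rw [← hf σ]
  have : expOf m = Finsupp.mapDomain σ (expOf (m ∘ σ)) := by
    ext i
    obtain ⟨j, rfl⟩ := σ.surjective i
    rw [Finsupp.mapDomain_apply σ.injective]
    simp [expOf]
  rw [this, coeff_rename_mapDomain _ σ.injective]

theorem coefMap_inj (n d : ℕ) : Function.Injective (coefMap n d) := by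
  rw [injective_iff_map_eq_zero]
  rintro ⟨f, hf⟩ h0
  have hf' := mem_WS.1 hf
  ext m
  simp only [ZeroMemClass.coe_zero, coeff_zero]
  by_contra hm
  have hmd : csize (fun i => m i) ≤ d := by
    refine le_trans ?_ hf'.2
    have := le_totalDegree (mem_support_iff.2 hm)
    rw [Finsupp.sum_fintype _ _ (by simp)] at this
    exact this
  let σ := Tuple.sort (fun i => OrderDual.toDual (m i))
  have hσ := Tuple.monotone_sort (fun i => OrderDual.toDual (m i))
  let ν : PB n d := ⟨(fun i => m i) ∘ σ, by
    refine ⟨fun i j hij => hσ hij, ?_⟩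
    rw [csize] at hmd ⊢
    rw [← Equiv.sum_comp σ] at hmd
    exact hmd⟩
  have := congrFun h0 ν
  simp only [coefMap, LinearMap.pi_apply, LinearMap.comp_apply, Submodule.subtype_apply,
    lcoeff_apply, Pi.zero_apply, ν] at this
  rw [coeff_symm hf'.1] at this
  apply hm
  rw [← this]
  congr 1
  ext i; simp [expOf]

theorem evMap_surj (n d : ℕ) : Function.Surjective (evMap n d) := by
  rw [← LinearMap.range_eq_top]
  by_contra hne
  obtain ⟨w, hw, hle⟩ := Submodule.exists_le_ker_of_lt_top _ (lt_top_iff_ne_top.2 hne)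
  have hex : ∃ ν, w (Pi.single ν 1) ≠ 0 := by
    by_contra hc
    push Not at hc
    apply hw
    refine LinearMap.pi_ext' fun ν => ?_
    ext
    simp [hc ν]
  obtain ⟨ν0, hν0⟩ := hex
  obtain ⟨l, hl, hmax⟩ := Finset.exists_max_image
    (Finset.univ.filter (fun ν : PB n d => w (Pi.single ν 1) ≠ 0))
    (fun ν => (toLex (ν.1 ∘ Fin.rev) : Lex (Fin n → ℕ))) ⟨ν0, by simpa using hν0⟩
  simp only [Finset.mem_filter, Finset.mem_univ, true_and] at hl hmax
  have hmem : testP l.1 ∈ WS n d := mem_WS.2 ⟨testP_symm _, (testP_deg _ l.2.1).trans l.2.2⟩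
  have h1 : w (evMap n d ⟨testP l.1, hmem⟩) = 0 := hle ⟨_, rfl⟩
  rw [LinearMap.pi_apply_eq_sum_univ, Finset.sum_eq_single l] at h1
  · rw [evMap_apply] at h1
    rcases smul_eq_zero.1 h1 with h | h
    · exact testP_ne _ h
    · exact hl (by
        rw [← h]; congr 1; funext j; simp [Pi.single_apply, eq_comm])
  · intro ν _ hνl
    by_cases hwν : w (Pi.single ν 1) = 0
    · rw [show (fun j => if ν = j then (1 : K) else 0) = Pi.single ν 1 by
        funext j; simp [Pi.single_apply, eq_comm]]
      rw [hwν, smul_zero]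
    · have hlt := lt_of_le_of_ne (hmax ν hwν) (fun h => hνl (by
        apply Subtype.ext
        have h' := congrArg ofLex h
        simp only [ofLex_toLex] at h'
        funext i
        have := congrFun h' (Fin.rev i)
        simpa using this))
      obtain ⟨i, hi1, hi2⟩ := hlt
      simp only [Function.comp, Pi.toLex_apply] at hi1 hi2
      rw [evMap_apply]
      have : eval (hp ν.1) (testP l.1) = 0 := by
        refine testP_zero l.1 ν.1 ν.2.1 (Fin.rev i) (Fin.rev i).2 ?_ ?_
        · rw [cext_fin, cext_fin]; exact hi2
        · intro j hj1 hj2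
          have := hi1 (Fin.rev ⟨j, hj2⟩) (by
            rw [Fin.lt_def, Fin.val_rev]; rw [Fin.val_rev] at hj1; simp; omega)
          simp at this
          simp [cext, hj2, this]
      rw [this, zero_smul]
  · simp

theorem inj_of_surj_of_inj {F V W : Type*} [Field F] [AddCommGroup V] [Module F V] [AddCommGroup W]
    [Module F W] [Module.Finite F V] (c e : W →ₗ[F] V) (hc : Function.Injective c)
    (he : Function.Surjective e) : Function.Injective e := by
  have : Module.Finite F W := Module.Finite.of_injective c hc
  have h1 := LinearMap.finrank_le_finrank_of_injective hc
  have h2 := LinearMap.finrank_range_le e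
  rw [LinearMap.range_eq_top.2 he, finrank_top] at h2
  exact (LinearMap.injective_iff_surjective_of_finrank_eq_finrank (le_antisymm h1 h2)).2 he

theorem evMap_inj (n d : ℕ) : Function.Injective (evMap n d) := by
  have h := @inj_of_surj_of_inj K (PB n d → K) (WS n d) inferInstance inferInstance inferInstance
    inferInstance inferInstance inferInstance
  exact h (coefMap n d) (evMap n d) (coefMap_inj n d) (evMap_surj n d)

theorem nondeg {n d : ℕ} {f : MvPolynomial (Fin n) K} (hf : f.IsSymmetric) (hd : f.totalDegree ≤ d)
    (h : ∀ ν : Fin n → ℕ, IsPartition ν → csize ν ≤ d → eval (hp ν) f = 0) : f = 0 := by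
  have h1 : (⟨f, mem_WS.2 ⟨hf, hd⟩⟩ : WS n d) = 0 := by
    apply evMap_inj n d
    funext ν
    rw [evMap_apply, map_zero]
    exact h ν.1 ν.2.1 ν.2.2
  exact congrArg Subtype.val h1

theorem exists_interp {n : ℕ} (l : Fin n → ℕ) (hl : IsPartition l) :
    ∃ f : MvPolynomial (Fin n) K, f.IsSymmetric ∧ f.totalDegree ≤ csize l ∧ f ≠ 0 ∧
      ∀ ν : Fin n → ℕ, IsPartition ν → csize ν ≤ csize l → ν ≠ l → eval (hp ν) f = 0 := by
  obtain ⟨f, hf⟩ := evMap_surj n (csize l) (Pi.single ⟨l, hl, le_rfl⟩ 1)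
  refine ⟨f.1, (mem_WS.1 f.2).1, (mem_WS.1 f.2).2, ?_, ?_⟩
  · intro h0
    have := congrFun hf ⟨l, hl, le_rfl⟩
    rw [evMap_apply, h0] at this
    simp at this
  · intro ν h1 h2 h3
    have := congrFun hf ⟨ν, h1, h2⟩
    rw [evMap_apply, Pi.single_eq_of_ne (by simpa using h3)] at this
    exact this

/-! ### Part C : the difference operator -/

section opdef
variable {n : ℕ} {R : Type*} [CommRing R]

/-- the `p`-integer -/
def br (p : R) (m : ℕ) : R := ∑ k ∈ Finset.range m, p ^ k

theorem br_map {S : Type*} [CommRing S] (φ : R →+* S) (p : R) (m : ℕ) : φ (br p m) = br (φ p) m := by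
  simp [br]

/-- the `p`-derivative -/
def qd (p : R) (i : Fin n) : MvPolynomial (Fin n) R →ₗ[R] MvPolynomial (Fin n) R :=
  (basisMonomials (Fin n) R).constr R (fun a => monomial (a - Finsupp.single i 1) (br p (a i)))

theorem qd_monomial (p : R) (i : Fin n) (a : Fin n →₀ ℕ) (c : R) :
    qd p i (monomial a c) = monomial (a - Finsupp.single i 1) (c * br p (a i)) := by
  have h : monomial a c = c • (basisMonomials (Fin n) R a) := by
    simp [smul_monomial]
  rw [h, map_smul, qd, Module.Basis.constr_basis, smul_monomial, smul_eq_mul]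

theorem X_mul_qd_monomial (p : R) (i : Fin n) (a : Fin n →₀ ℕ) (c : R) :
    X i * qd p i (monomial a c) = monomial a (c * br p (a i)) := by
  rw [qd_monomial]
  by_cases h : a i = 0
  · simp [h, br]
  · rw [X, monomial_mul, one_mul, add_tsub_cancel_of_le]
    rw [Finsupp.single_le_iff]; omega

theorem coeff_X_mul_qd (p : R) (i : Fin n) (f : MvPolynomial (Fin n) R) (a : Fin n →₀ ℕ) :
    coeff a (X i * qd p i f) = br p (a i) * coeff a f := by
  induction f using MvPolynomial.induction_on' with
  | monomial b c =>
    rw [X_mul_qd_monomial, coeff_monomial, coeff_monomial]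
    split_ifs with h
    · rw [h, mul_comm]
    · simp
  | add f g hf hg => rw [map_add, mul_add, coeff_add, hf, hg, coeff_add, mul_add]

theorem qd_deg (p : R) (i : Fin n) (f : MvPolynomial (Fin n) R) :
    (X i * qd p i f).totalDegree ≤ f.totalDegree := by
  refine Finset.sup_mono fun a => ?_
  rw [mem_support_iff, mem_support_iff, coeff_X_mul_qd]
  exact right_ne_zero_of_mul

theorem qd_map {S : Type*} [CommRing S] (φ : R →+* S) (p : R) (i : Fin n)
    (f : MvPolynomial (Fin n) R) : map φ (qd p i f) = qd (φ p) i (map φ f) := by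
  induction f using MvPolynomial.induction_on' with
  | monomial b c => rw [qd_monomial, map_monomial, map_monomial, qd_monomial, map_mul, br_map]
  | add f g hf hg => simp only [map_add, hf, hg]

theorem qd_one (i : Fin n) (f : MvPolynomial (Fin n) R) : qd 1 i f = pderiv i f := by
  induction f using MvPolynomial.induction_on' with
  | monomial b c => rw [qd_monomial, pderiv_monomial]; simp [br]
  | add f g hf hg => simp only [map_add, hf, hg]

theorem qd_rename (p : R) (i : Fin n) (σ : Equiv.Perm (Fin n)) (f : MvPolynomial (Fin n) R) :
    rename σ (qd p i f) = qd p (σ i) (rename σ f) := by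
  induction f using MvPolynomial.induction_on' with
  | monomial b c =>
    rw [qd_monomial, rename_monomial, rename_monomial, qd_monomial,
      Finsupp.mapDomain_apply σ.injective]
    have key : Finsupp.mapDomain σ (b - Finsupp.single i 1) =
        Finsupp.mapDomain σ b - Finsupp.single (σ i) 1 := ?_
    · rw [key]
    ext j
    obtain ⟨k, rfl⟩ := σ.surjective j
    rw [Finsupp.mapDomain_apply σ.injective, Finsupp.tsub_apply, Finsupp.tsub_apply,
      Finsupp.mapDomain_apply σ.injective]
    simp [Finsupp.single_apply]
  | add f g hf hg => simp only [map_add, hf, hg]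

theorem br_mul (p : R) (m : ℕ) : (1 - p) * br p m = 1 - p ^ m := by
  rw [br, mul_neg_geom_sum]

theorem qd_eval (p : R) (i : Fin n) (f : MvPolynomial (Fin n) R) (x : Fin n → R) :
    (1 - p) * (x i * eval x (qd p i f)) = eval x f - eval (Function.update x i (p * x i)) f := by
  have : x i * eval x (qd p i f) = eval x (X i * qd p i f) := by simp
  rw [this]
  induction f using MvPolynomial.induction_on' with
  | monomial b c =>
    rw [X_mul_qd_monomial, eval_monomial, eval_monomial, eval_monomial,
      Finsupp.prod_fintype _ _ (by simp), Finsupp.prod_fintype _ _ (by simp)]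
    have h : ∏ k, Function.update x i (p * x i) k ^ b k = p ^ b i * ∏ k, x k ^ b k := by
      rw [← Finset.mul_prod_erase _ _ (Finset.mem_univ i), ← Finset.mul_prod_erase _ (fun k => x k ^ b k) (Finset.mem_univ i)]
      rw [Function.update_self, mul_pow, mul_assoc]
      congr 2
      refine Finset.prod_congr rfl fun k hk => ?_
      rw [Function.update_of_ne (Finset.ne_of_mem_erase hk)]
    rw [h]
    linear_combination (c * ∏ k, x k ^ b k) * br_mul p (b i)
  | add f g hf hg => 
    have hf' := hf (by simp)
    have hg' := hg (by simp)
    simp only [map_add, mul_add] at hf' hg' ⊢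
    linear_combination hf' + hg'

/-- partial double Vandermonde -/
def Mi (R : Type*) [CommRing R] {n : ℕ} (i : Fin n) : MvPolynomial (Fin n) R :=
  ∏ k ∈ Finset.univ.erase i, ∏ j ∈ Finset.univ.erase k, (X k - X j)

/-- double Vandermonde -/
def D2 (R : Type*) [CommRing R] (n : ℕ) : MvPolynomial (Fin n) R :=
  ∏ k, ∏ j ∈ Finset.univ.erase k, (X k - X j)

/-- leading coefficient of the operator -/
def Ci (t s : R) (i : Fin n) : MvPolynomial (Fin n) R :=
  (X i - C s) * (∏ j ∈ Finset.univ.erase i, (X i - C t * X j)) * Mi R i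

/-- the cleared operator -/
def NN (p t s : R) (f : MvPolynomial (Fin n) R) : MvPolynomial (Fin n) R :=
  ∑ i, Ci t s i * qd p i f

theorem D2_eq (i : Fin n) : D2 R n = (∏ j ∈ Finset.univ.erase i, (X i - X j)) * Mi R i := by
  rw [D2, Mi, Finset.mul_prod_erase (Finset.univ) (fun k : Fin n => ∏ j ∈ Finset.univ.erase k, (X k - X j : MvPolynomial (Fin n) R)) (Finset.mem_univ i)]

theorem Mi_map {S : Type*} [CommRing S] (φ : R →+* S) (i : Fin n) : map φ (Mi R i) = Mi S i := by
  simp [Mi, map_prod]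

theorem D2_map {S : Type*} [CommRing S] (φ : R →+* S) : map φ (D2 R n) = D2 S n := by
  simp [D2, map_prod]

theorem NN_map {S : Type*} [CommRing S] (φ : R →+* S) (p t s : R) (f : MvPolynomial (Fin n) R) :
    map φ (NN p t s f) = NN (φ p) (φ t) (φ s) (map φ f) := by
  simp [NN, Ci, qd_map, Mi_map, map_prod]

theorem prod_erase_perm {M : Type*} [CommMonoid M] (σ : Equiv.Perm (Fin n)) (i : Fin n) (g : Fin n → M) :
    ∏ j ∈ Finset.univ.erase i, g (σ j) = ∏ j ∈ Finset.univ.erase (σ i), g j := by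
  refine Finset.prod_equiv σ (fun j => ?_) (fun j _ => rfl)
  simp

theorem Mi_rename (σ : Equiv.Perm (Fin n)) (i : Fin n) : rename σ (Mi R i) = Mi R (σ i) := by
  rw [Mi, Mi, ← prod_erase_perm, map_prod]
  refine Finset.prod_congr rfl fun k _ => ?_
  rw [← prod_erase_perm, map_prod]
  simp

theorem D2_symm : (D2 R n).IsSymmetric := by
  intro σ
  rw [D2, map_prod]
  rw [← Equiv.prod_comp σ (fun k => ∏ j ∈ Finset.univ.erase k, (X k - X j : MvPolynomial (Fin n) R))]
  refine Finset.prod_congr rfl fun k _ => ?_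
  rw [← prod_erase_perm, map_prod]
  simp

theorem Ci_rename (t s : R) (σ : Equiv.Perm (Fin n)) (i : Fin n) :
    rename σ (Ci t s i) = Ci t s (σ i) := by
  rw [Ci, Ci, map_mul, map_mul, Mi_rename, ← prod_erase_perm, map_prod]
  simp

theorem NN_symm (p t s : R) {f : MvPolynomial (Fin n) R} (hf : f.IsSymmetric) :
    (NN p t s f).IsSymmetric := by
  intro σ
  rw [NN, map_sum, ← Equiv.sum_comp σ (fun i => Ci t s i * qd p i f)]
  refine Finset.sum_congr rfl fun i _ => ?_
  rw [map_mul, Ci_rename, qd_rename, hf σ]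

theorem NN_add (p t s : R) (f g : MvPolynomial (Fin n) R) :
    NN p t s (f + g) = NN p t s f + NN p t s g := by
  simp [NN, mul_add, Finset.sum_add_distrib]

theorem NN_smul (p t s c : R) (f : MvPolynomial (Fin n) R) :
    NN p t s (C c * f) = C c * NN p t s f := by
  simp only [NN, C_mul', map_smul, Finset.smul_sum, mul_smul_comm]

theorem dvd_Mi (a b i : Fin n) (hab : a ≠ b) : (X a - X b : MvPolynomial (Fin n) R) ∣ Mi R i := by
  by_cases h : a = i
  · subst h
    have h1 : (X b - X a : MvPolynomial (Fin n) R) ∣ Mi R a := by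
      refine (Finset.dvd_prod_of_mem (fun j => (X b - X j : MvPolynomial (Fin n) R)) (s := Finset.univ.erase b) (a := a) (by simpa using hab)).trans ?_
      exact Finset.dvd_prod_of_mem _ (by simpa using hab.symm)
    rw [← neg_sub, neg_dvd]; exact h1
  · refine (Finset.dvd_prod_of_mem (fun j => (X a - X j : MvPolynomial (Fin n) R)) (s := Finset.univ.erase a) (a := b) (by simpa using hab.symm)).trans ?_
    exact Finset.dvd_prod_of_mem _ (by simpa using h)

theorem dvd_NN (p t s : R) (f : MvPolynomial (Fin n) R) (a b : Fin n) (hab : a ≠ b) :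
    (X a - X b) ∣ NN p t s f :=
  Finset.dvd_sum fun i _ => Dvd.dvd.mul_right (Dvd.dvd.mul_left (dvd_Mi a b i hab) _) _

theorem NN_one_mul (t s : R) (f g : MvPolynomial (Fin n) R) :
    NN 1 t s (f * g) = f * NN 1 t s g + g * NN 1 t s f := by
  simp only [NN, qd_one, Derivation.leibniz, smul_eq_mul, Finset.mul_sum, ← Finset.sum_add_distrib]
  refine Finset.sum_congr rfl fun i _ => by ring

end opdef

/-! ### Part D : Lagrange interpolation identities -/

section lagr
variable {n : ℕ} {F : Type*} [Field F]

theorem lag_aux (x : Fin n → F) (hx : Function.Injective x) (h0 : ∀ i, x i ≠ 0) (hn : 0 < n)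
    (R : Polynomial F) (hR : R.natDegree ≤ n) :
    ∑ i, R.eval (x i) / (x i * ∏ j ∈ Finset.univ.erase i, (x i - x j)) =
      R.coeff n - R.coeff 0 / ∏ i, (- x i) := by
  set χ : Polynomial F := ∏ i, (Polynomial.X - Polynomial.C (x i)) with hχ
  have hχd : χ.natDegree = n := by rw [hχ, Polynomial.natDegree_finsetProd_X_sub_C_eq_card]; simp
  have hχm : χ.Monic := Polynomial.monic_prod_of_monic _ _ fun i _ => Polynomial.monic_X_sub_C _
  have hχ0 : χ.coeff 0 = ∏ i, (- x i) := by
    rw [Polynomial.coeff_zero_eq_eval_zero, hχ, Polynomial.eval_prod]; simp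
  have hχne : ∏ i, (- x i) ≠ 0 := Finset.prod_ne_zero_iff.2 fun i _ => neg_ne_zero.2 (h0 i)
  set S := R - Polynomial.C (R.coeff 0 / ∏ i, (- x i)) * χ with hS
  have hS0 : S.coeff 0 = 0 := by
    rw [hS, Polynomial.coeff_sub, Polynomial.coeff_C_mul, hχ0]; field_simp; simp
  have hSX : S = S.divX * Polynomial.X := by
    have := Polynomial.divX_mul_X_add S
    rw [hS0] at this; simpa using this.symm
  have hSd : S.natDegree ≤ n := by
    refine (Polynomial.natDegree_sub_le _ _).trans (max_le hR ?_)
    exact (Polynomial.natDegree_C_mul_le _ _).trans hχd.le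
  have hdeg : S.divX.degree < (Finset.univ : Finset (Fin n)).card := by
    rw [Finset.card_univ, Fintype.card_fin]
    rw [Polynomial.degree_lt_iff_coeff_zero]
    intro m hm
    rw [Polynomial.coeff_divX]
    exact Polynomial.coeff_eq_zero_of_natDegree_lt (by omega)
  have hl := Lagrange.coeff_eq_sum (s := Finset.univ) (v := x) hx.injOn hdeg
  rw [Finset.card_univ, Fintype.card_fin, Polynomial.coeff_divX, Nat.sub_add_cancel hn] at hl
  have hSn : S.coeff n = R.coeff n - R.coeff 0 / ∏ i, (- x i) := by
    rw [hS, Polynomial.coeff_sub, Polynomial.coeff_C_mul]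
    have : χ.coeff n = 1 := by rw [← hχd]; exact hχm
    rw [this, mul_one]
  rw [← hSn, hl]
  refine Finset.sum_congr rfl fun i _ => ?_
  have hev : R.eval (x i) = S.divX.eval (x i) * x i := by
    have h1 : S.eval (x i) = S.divX.eval (x i) * x i := by
      conv_lhs => rw [hSX]
      simp
    rw [← h1, hS]
    have : χ.eval (x i) = 0 := by
      rw [hχ, Polynomial.eval_prod]
      exact Finset.prod_eq_zero (Finset.mem_univ i) (by simp)
    simp [this]
  rw [hev, mul_comm (x i), mul_div_mul_right _ _ (h0 i)]

theorem coeff_prod_aux {ι : Type*} (s : Finset ι) (a : ι → F) (h : ∀ i ∈ s, a i ≠ 0) :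
    (∏ i ∈ s, (Polynomial.X - Polynomial.C (a i))).coeff 1 = (∏ i ∈ s, (- a i)) * (- ∑ i ∈ s, (a i)⁻¹) := by
  induction s using Finset.induction_on with
  | empty => simp [Polynomial.coeff_one]
  | insert b s hb ih =>
    rw [Finset.prod_insert hb, Finset.prod_insert hb, Finset.sum_insert hb, sub_mul,
      Polynomial.coeff_sub, Polynomial.coeff_C_mul, Polynomial.coeff_X_mul,
      ih (fun i hi => h i (Finset.mem_insert_of_mem hi))]
    have hb0 := h b (Finset.mem_insert_self _ _)
    have : (∏ i ∈ s, (Polynomial.X - Polynomial.C (a i))).coeff 0 = ∏ i ∈ s, (- a i) := by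
      rw [Polynomial.coeff_zero_eq_eval_zero, Polynomial.eval_prod]; simp
    rw [this]
    field_simp
    ring

theorem lag_main (x : Fin n → F) (hx : Function.Injective x) (h0 : ∀ i, x i ≠ 0) (hn : 0 < n)
    (t s : F) (ht0 : t ≠ 0) (ht : t ≠ 1) :
    ∑ i, (x i - s) * (∏ j ∈ Finset.univ.erase i, (x i - t * x j)) /
        (x i * ∏ j ∈ Finset.univ.erase i, (x i - x j)) =
      ∑ i ∈ Finset.range n, t ^ i - s * t ^ (n - 1) * ∑ i, (x i)⁻¹ := by
  set χ : Polynomial F := ∏ i, (Polynomial.X - Polynomial.C (x i)) with hχ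
  set P : Polynomial F := ∏ i, (Polynomial.X - Polynomial.C (t * x i)) with hP
  have hχd : χ.natDegree = n := by rw [hχ, Polynomial.natDegree_finsetProd_X_sub_C_eq_card]; simp
  have hPd : P.natDegree = n := by rw [hP, Polynomial.natDegree_finsetProd_X_sub_C_eq_card]; simp
  have hχm : χ.Monic := Polynomial.monic_prod_of_monic _ _ fun i _ => Polynomial.monic_X_sub_C _
  have hPm : P.Monic := Polynomial.monic_prod_of_monic _ _ fun i _ => Polynomial.monic_X_sub_C _
  have hχne : ∏ i, (- x i) ≠ 0 := Finset.prod_ne_zero_iff.2 fun i _ => neg_ne_zero.2 (h0 i)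
  have hχ0 : χ.coeff 0 = ∏ i, (- x i) := by
    rw [Polynomial.coeff_zero_eq_eval_zero, hχ, Polynomial.eval_prod]; simp
  have hprod : ∏ i, (- (t * x i)) = t ^ n * ∏ i, (- x i) := by
    rw [show t ^ n = ∏ _i : Fin n, t by simp, ← Finset.prod_mul_distrib]
    refine Finset.prod_congr rfl fun i _ => by ring
  have hP0 : P.coeff 0 = t ^ n * ∏ i, (- x i) := by
    rw [Polynomial.coeff_zero_eq_eval_zero, hP, Polynomial.eval_prod, ← hprod]; simp
  have hPev : ∀ i, P.eval (x i) = (1 - t) * x i * ∏ j ∈ Finset.univ.erase i, (x i - t * x j) := by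
    intro i
    rw [hP, Polynomial.eval_prod, ← Finset.mul_prod_erase _ _ (Finset.mem_univ i)]
    simp only [Polynomial.eval_sub, Polynomial.eval_X, Polynomial.eval_C]; ring
  have hχev : ∀ i, χ.eval (x i) = 0 := by
    intro i
    rw [hχ, Polynomial.eval_prod]
    exact Finset.prod_eq_zero (Finset.mem_univ i) (by simp)
  have h1 := lag_aux x hx h0 hn P hPd.le
  set Q := (P - Polynomial.C (t ^ n) * χ) with hQ
  have hQ0 : Q.coeff 0 = 0 := by
    rw [hQ, Polynomial.coeff_sub, Polynomial.coeff_C_mul, hχ0, hP0, sub_self]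
  have hQX : Q = Q.divX * Polynomial.X := by
    have := Polynomial.divX_mul_X_add Q
    rw [hQ0] at this; simpa using this.symm
  have hQd : Q.natDegree ≤ n := by
    refine (Polynomial.natDegree_sub_le _ _).trans (max_le hPd.le ?_)
    exact (Polynomial.natDegree_C_mul_le _ _).trans hχd.le
  have h2 := lag_aux x hx h0 hn Q.divX (by rw [Polynomial.natDegree_divX_eq_natDegree_tsub_one]; omega)
  have hQev : ∀ i, Q.divX.eval (x i) = (1 - t) * ∏ j ∈ Finset.univ.erase i, (x i - t * x j) := by
    intro i
    have h3 : Q.eval (x i) = Q.divX.eval (x i) * x i := by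
      conv_lhs => rw [hQX]
      simp
    have h4 : Q.eval (x i) = P.eval (x i) := by rw [hQ]; simp [hχev]
    rw [h4, hPev] at h3
    apply mul_right_cancel₀ (h0 i)
    rw [← h3]; ring
  have hPn : P.coeff n = 1 := by rw [← hPd]; exact hPm
  have hPx : P.coeff 1 = t ^ n * (∏ i, (- x i)) * (- ∑ i, (t * x i)⁻¹) := by
    rw [hP, coeff_prod_aux _ _ (fun i _ => mul_ne_zero ht0 (h0 i)), hprod]
  have hχx : χ.coeff 1 = (∏ i, (- x i)) * (- ∑ i, (x i)⁻¹) := by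
    rw [hχ, coeff_prod_aux _ _ (fun i _ => h0 i)]
  rw [hPn, hP0, mul_div_assoc, div_self hχne, mul_one] at h1
  have hsum : ∑ i, (t * x i)⁻¹ = t⁻¹ * ∑ i, (x i)⁻¹ := by
    rw [Finset.mul_sum]; exact Finset.sum_congr rfl fun i _ => mul_inv _ _
  have hR : Q.divX.coeff n - Q.divX.coeff 0 / ∏ i, (- x i) = (1 - t) * t ^ (n - 1) * ∑ i, (x i)⁻¹ := by
    rw [Polynomial.coeff_divX, Polynomial.coeff_divX, Polynomial.coeff_eq_zero_of_natDegree_lt (by omega : Q.natDegree < n + 1),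
      zero_add, hQ, Polynomial.coeff_sub, Polynomial.coeff_C_mul, hPx, hχx, hsum]
    obtain ⟨m, rfl⟩ : ∃ m, n = m + 1 := ⟨n - 1, by omega⟩
    rw [Nat.add_sub_cancel]
    field_simp
    ring
  rw [hR] at h2
  have ht1 : (1 - t) ≠ 0 := sub_ne_zero.2 (Ne.symm ht)
  apply mul_left_cancel₀ ht1
  rw [mul_sub, mul_neg_geom_sum, ← h1, Finset.mul_sum,
    show (1 - t) * (s * t ^ (n - 1) * ∑ i, (x i)⁻¹) = s * ((1 - t) * t ^ (n - 1) * ∑ i, (x i)⁻¹) by ring,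
    ← h2, Finset.mul_sum, ← Finset.sum_sub_distrib]
  refine Finset.sum_congr rfl fun i _ => ?_
  rw [hPev, hQev]
  ring

end lagr

/-! ### Part E : divisibility by the double Vandermonde, eigenvalue lemma -/

section divi
variable {n : ℕ} {F : Type*} [Field F]

theorem irr_sub (a b : Fin n) (hab : a ≠ b) : Irreducible (X a - X b : MvPolynomial (Fin n) F) := by
  have hh : (X a - X b : MvPolynomial (Fin n) F).IsHomogeneous 1 := (isHomogeneous_X _ _).sub (isHomogeneous_X _ _)
  have hc : coeff (Finsupp.single a 1) (X a - X b : MvPolynomial (Fin n) F) = 1 := by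
    have hb : ¬ (Finsupp.single b 1 = (Finsupp.single a 1 : Fin n →₀ ℕ)) := fun h =>
      hab ((Finsupp.single_left_inj one_ne_zero).1 h).symm
    rw [coeff_sub, coeff_X, coeff_X, if_neg hb, sub_zero, if_pos rfl]
  apply irreducible_of_totalDegree_eq_one
  · apply hh.totalDegree
    intro h
    rw [h] at hc
    simp at hc
  · intro x hx
    have := hx (Finsupp.single a 1)
    rw [hc] at this
    exact isUnit_of_dvd_one this

theorem sub_swap_dvd (a b : Fin n) (u : MvPolynomial (Fin n) F) :
    (X a - X b) ∣ u - rename (Equiv.swap a b) u := by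
  rw [← Ideal.mem_span_singleton, ← Ideal.Quotient.eq]
  set I := Ideal.span {(X a - X b : MvPolynomial (Fin n) F)} with hI
  have hab : Ideal.Quotient.mk I (X a) = Ideal.Quotient.mk I (X b) := by
    rw [Ideal.Quotient.eq, hI]; exact Ideal.mem_span_singleton_self _
  have : (Ideal.Quotient.mkₐ F I) = (Ideal.Quotient.mkₐ F I).comp (rename (Equiv.swap a b)) := by
    ext i
    simp only [AlgHom.comp_apply, rename_X, Ideal.Quotient.mkₐ_eq_mk]
    by_cases h1 : i = a
    · subst h1; rw [Equiv.swap_apply_left, hab]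
    · by_cases h2 : i = b
      · subst h2; rw [Equiv.swap_apply_right, hab]
      · rw [Equiv.swap_apply_of_ne_of_ne h1 h2]
  exact DFunLike.congr_fun this u

theorem sq_dvd_of_symm [CharZero F] (a b : Fin n) (hab : a ≠ b) (g : MvPolynomial (Fin n) F)
    (hg : g.IsSymmetric) (h : (X a - X b) ∣ g) : (X a - X b) ^ 2 ∣ g := by
  obtain ⟨u, hu⟩ := h
  have h1 := hg (Equiv.swap a b)
  rw [hu, map_mul, map_sub, rename_X, rename_X, Equiv.swap_apply_left, Equiv.swap_apply_right] at h1
  have h2 : u = - rename (Equiv.swap a b) u := by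
    apply mul_left_cancel₀ (irr_sub (F := F) a b hab).ne_zero
    rw [← h1]; ring
  have h3 := sub_swap_dvd a b u
  have h4 : u - rename (Equiv.swap a b) u = C (2 : F) * u := by
    have : rename (Equiv.swap a b) u = - u := by rw [eq_neg_iff_add_eq_zero, add_comm, ← eq_neg_iff_add_eq_zero]; exact h2
    rw [this, show (C (2 : F) : MvPolynomial (Fin n) F) = 2 from map_ofNat C 2]; ring
  rw [h4] at h3
  have h5 : (X a - X b) ∣ u := by
    have : u = C (2⁻¹ : F) * (C (2 : F) * u) := by
      rw [← mul_assoc, ← C_mul, inv_mul_cancel₀ two_ne_zero, C_1, one_mul]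
    rw [this]; exact Dvd.dvd.mul_left h3 _
  rw [hu, pow_two]
  exact mul_dvd_mul_left _ h5

theorem relprime_sub (a b c d : Fin n) (hab : a < b) (hcd : c < d) (h : (a, b) ≠ (c, d)) :
    IsRelPrime (X a - X b : MvPolynomial (Fin n) F) (X c - X d) := by
  rw [(irr_sub a b hab.ne).isRelPrime_iff_not_dvd]
  rintro ⟨u, hu⟩
  have hex : ∃ e : Fin n, e ≠ a ∧ e ≠ b ∧ (e = c ∨ e = d) := by
    by_cases hca : c = a
    · refine ⟨d, ?_, ?_, Or.inr rfl⟩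
      · rintro rfl; exact absurd hca hcd.ne
      · rintro rfl; exact h (by rw [hca])
    · by_cases hcb : c = b
      · refine ⟨d, ?_, ?_, Or.inr rfl⟩
        · rintro rfl; exact absurd hab (by rw [← hcb]; exact not_lt_of_gt hcd)
        · rintro rfl; exact absurd hcb hcd.ne
      · exact ⟨c, hca, hcb, Or.inl rfl⟩
  obtain ⟨e, h1, h2, h3⟩ := hex
  have := congrArg (eval (Pi.single e (1 : F))) hu
  simp only [map_sub, map_mul, eval_X, Pi.single_eq_of_ne h1.symm, Pi.single_eq_of_ne h2.symm, sub_self, zero_mul] at this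
  rcases h3 with rfl | rfl
  · rw [Pi.single_eq_same, Pi.single_eq_of_ne hcd.ne'] at this; simp at this
  · rw [Pi.single_eq_same, Pi.single_eq_of_ne hcd.ne] at this; simp at this

theorem prod_sq_dvd [CharZero F] (g : MvPolynomial (Fin n) F)
    (hg : g.IsSymmetric) (h : ∀ a b : Fin n, a ≠ b → (X a - X b) ∣ g) : D2 F n ∣ g := by
  set T : Finset (Fin n × Fin n) := Finset.univ.filter (fun z => z.1 < z.2) with hT
  have h1 : (∏ z ∈ T, (X z.1 - X z.2 : MvPolynomial (Fin n) F) ^ 2) ∣ g := by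
    apply Finset.prod_dvd_of_isRelPrime
    · rintro ⟨a, b⟩ hab ⟨c, d⟩ hcd hne
      simp only [hT, Finset.coe_filter, Finset.mem_univ, true_and, Set.mem_ofPred_eq] at hab hcd
      exact (relprime_sub a b c d hab hcd hne).pow
    · rintro ⟨a, b⟩ hab
      simp only [hT, Finset.mem_filter, Finset.mem_univ, true_and] at hab
      exact sq_dvd_of_symm a b hab.ne g hg (h a b hab.ne)
  refine dvd_trans ?_ h1
  have h2 : D2 F n = ∏ z ∈ (Finset.univ : Finset (Fin n × Fin n)).filter (fun z => z.1 ≠ z.2),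
      (X z.1 - X z.2 : MvPolynomial (Fin n) F) := by
    rw [D2, Finset.prod_filter, Fintype.prod_prod_type]
    refine Finset.prod_congr rfl fun k _ => ?_
    rw [← Finset.prod_filter]
    refine Finset.prod_congr ?_ fun _ _ => rfl
    ext j; simp [eq_comm]
  have h3 : (Finset.univ : Finset (Fin n × Fin n)).filter (fun z => z.1 ≠ z.2) =
      T ∪ Finset.univ.filter (fun z => z.2 < z.1) := by
    ext z; simp [hT, lt_or_lt_iff_ne]
  have hdis : Disjoint T (Finset.univ.filter (fun z : Fin n × Fin n => z.2 < z.1)) := by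
    rw [Finset.disjoint_left]; intro z; simp only [hT, Finset.mem_filter, Finset.mem_univ, true_and]
    exact fun h => not_lt_of_gt h
  have h4 : ∏ z ∈ Finset.univ.filter (fun z : Fin n × Fin n => z.2 < z.1), (X z.1 - X z.2 : MvPolynomial (Fin n) F)
      = ∏ z ∈ T, (X z.2 - X z.1) := by
    refine Finset.prod_equiv (Equiv.prodComm _ _) ?_ ?_
    · intro z; simp [hT]
    · intro z _; simp
  rw [h2, h3, Finset.prod_union hdis, h4, ← Finset.prod_mul_distrib]
  refine Finset.prod_dvd_prod_of_dvd _ _ fun z _ => ?_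
  exact ⟨-1, by ring⟩

theorem D2_ne : D2 F n ≠ 0 := by
  rw [D2, Finset.prod_ne_zero_iff]; intro k _
  rw [Finset.prod_ne_zero_iff]; intro j hj
  exact (irr_sub k j (Finset.ne_of_mem_erase hj).symm).ne_zero

theorem D2_deg : (D2 F n).totalDegree = n * (n - 1) := by
  have h : (D2 F n).IsHomogeneous (∑ _k : Fin n, (n - 1)) := by
    refine IsHomogeneous.prod _ _ _ fun k _ => ?_
    have h2 : (∏ j ∈ Finset.univ.erase k, (X k - X j : MvPolynomial (Fin n) F)).IsHomogeneous
        (∑ _j ∈ Finset.univ.erase k, 1) :=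
      IsHomogeneous.prod _ _ _ fun j _ => (isHomogeneous_X _ _).sub (isHomogeneous_X _ _)
    simpa using h2
  have := h.totalDegree D2_ne
  simpa using this

theorem Mi_deg (i : Fin n) : (Mi F i).totalDegree ≤ (n - 1) * (n - 1) := by
  have h : (Mi F i).IsHomogeneous (∑ _k ∈ (Finset.univ : Finset (Fin n)).erase i, (n - 1)) := by
    refine IsHomogeneous.prod _ _ _ fun k _ => ?_
    have h2 : (∏ j ∈ Finset.univ.erase k, (X k - X j : MvPolynomial (Fin n) F)).IsHomogeneous
        (∑ _j ∈ Finset.univ.erase k, 1) :=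
      IsHomogeneous.prod _ _ _ fun j _ => (isHomogeneous_X _ _).sub (isHomogeneous_X _ _)
    simpa using h2
  simpa using h.totalDegree_le

theorem Ci_deg (t s : F) (i : Fin n) : (Ci t s i).totalDegree ≤ 1 + n * (n - 1) := by
  rw [Ci]
  have h1 : (X i - C s : MvPolynomial (Fin n) F).totalDegree ≤ 1 := by
    refine (totalDegree_sub_C_le _ _).trans ?_
    simp
  have h2 : (∏ j ∈ Finset.univ.erase i, (X i - C t * X j : MvPolynomial (Fin n) F)).totalDegree ≤ n - 1 := by
    refine (totalDegree_finsetProd _ _).trans ?_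
    refine (Finset.sum_le_card_nsmul _ _ 1 fun j _ => ?_).trans (by simp)
    refine (totalDegree_sub _ _).trans (max_le (by simp) ?_)
    refine (totalDegree_mul _ _).trans (by simp)
  refine (totalDegree_mul _ _).trans ((add_le_add ((totalDegree_mul _ _).trans (add_le_add h1 h2)) (Mi_deg i)).trans ?_)
  have hn : 0 < n := i.pos
  obtain ⟨m, rfl⟩ : ∃ m, n = m + 1 := ⟨n - 1, by omega⟩
  simp only [Nat.add_sub_cancel]
  nlinarith

theorem NN_deg (p t s : F) (f : MvPolynomial (Fin n) F) :
    (NN p t s f).totalDegree ≤ n * (n - 1) + f.totalDegree := by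
  refine totalDegree_finsetSum_le fun i _ => ?_
  by_cases h : qd p i f = 0
  · simp [h]
  have h1 := qd_deg p i f
  rw [totalDegree_mul_of_isDomain (X_ne_zero _) h, totalDegree_X] at h1
  have := Ci_deg t s i
  refine (totalDegree_mul _ _).trans ?_
  omega

theorem NN_quot [CharZero F] (p t s : F) (f : MvPolynomial (Fin n) F) (hf : f.IsSymmetric) :
    ∃ h : MvPolynomial (Fin n) F, NN p t s f = D2 F n * h ∧ h.IsSymmetric ∧
      h.totalDegree ≤ f.totalDegree := by
  obtain ⟨h, hh⟩ := prod_sq_dvd (NN p t s f) (NN_symm p t s hf) (fun a b hab => dvd_NN p t s f a b hab)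
  refine ⟨h, hh, ?_, ?_⟩
  · intro σ
    have := NN_symm p t s hf σ
    rw [hh, map_mul, D2_symm] at this
    exact mul_left_cancel₀ D2_ne this
  · by_cases h0 : h = 0
    · simp [h0]
    have h1 := NN_deg p t s f
    rw [hh, totalDegree_mul_of_isDomain D2_ne h0, D2_deg] at h1
    omega

end divi

/-- eigenvalue -/
def ceig {R : Type*} [CommRing R] {n : ℕ} (p t : R) (l : Fin n → ℕ) : R := ∑ i : Fin n, t ^ (i : ℕ) * br p (l i)

theorem qinv_ne : (1 - qq⁻¹ : K) ≠ 0 := by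
  intro h
  have h1 : qq = 1 := by
    have := sub_eq_zero.1 h
    rw [eq_comm, inv_eq_one] at this
    exact this
  have := qt_inj (a := 1) (b := 0) (i := 0) (j := 0) (by simpa using h1)
  omega

theorem tt_ne_one : tt ≠ 1 := by
  intro h
  have := qt_inj (a := 0) (b := 0) (i := 1) (j := 0) (by simp [h])
  omega

theorem lower_eq {n : ℕ} (ν : Fin n → ℕ) (i : Fin n) (h : ν i ≠ 0) :
    Function.update (hp ν) i (qq⁻¹ * hp ν i) = hp (Function.update ν i (ν i - 1)) := by
  funext j
  by_cases hj : j = i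
  · subst hj
    simp only [Function.update_self, hp, hpt, cext_fin]
    obtain ⟨m, hm⟩ := Nat.exists_eq_succ_of_ne_zero h
    rw [hm, Nat.succ_sub_one, pow_succ]
    field_simp [qq_ne]
  · simp only [Function.update_of_ne hj, hp, hpt, cext_fin]

theorem lower_csize {n : ℕ} (ν : Fin n → ℕ) (i : Fin n) (h : ν i ≠ 0) :
    csize (Function.update ν i (ν i - 1)) + 1 = csize ν := by
  rw [csize, csize, Finset.sum_update_of_mem (Finset.mem_univ i), ← Finset.add_sum_erase _ _ (Finset.mem_univ i),
    Finset.sdiff_singleton_eq_erase]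
  omega

theorem eigen_term {n : ℕ} (l ν : Fin n → ℕ) (hν : IsPartition ν) (hs : csize ν ≤ csize l)
    (f : MvPolynomial (Fin n) K)
    (h : ∀ ν : Fin n → ℕ, IsPartition ν → csize ν ≤ csize l → ν ≠ l → eval (hp ν) f = 0)
    (i : Fin n) :
    eval (hp ν) (Ci tt (tt⁻¹ ^ (n - 1)) i) * eval (Function.update (hp ν) i (qq⁻¹ * hp ν i)) f = 0 := by
  have hin := i.2
  by_cases hlast : (i : ℕ) + 1 = n
  · by_cases h0 : ν i = 0
    · have : eval (hp ν) (Ci tt (tt⁻¹ ^ (n - 1)) i) = 0 := by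
        rw [Ci, map_mul, map_mul, map_sub, eval_X, eval_C, hp, hpt, cext_fin, h0]
        have : (i : ℕ) = n - 1 := by omega
        rw [this]; simp
      rw [this, zero_mul]
    · rw [lower_eq _ _ h0, h, mul_zero]
      · intro a b hab
        by_cases ha : a = i
        · subst ha
          have : b = a := le_antisymm (by rw [Fin.le_def]; omega) hab
          rw [this]
        · rw [Function.update_of_ne ha]
          refine le_trans ?_ (hν a b hab)
          by_cases hb : b = i
          · subst hb; rw [Function.update_self]; omega
          · rw [Function.update_of_ne hb]
      · have := lower_csize ν i h0; omega
      · intro he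
        have := lower_csize ν i h0
        rw [he] at this; omega
  · set j : Fin n := ⟨i + 1, by omega⟩ with hj
    have hij : j ≠ i := by intro h; rw [Fin.ext_iff, hj] at h; simp at h
    by_cases he : ν j = ν i
    · have : eval (hp ν) (Ci tt (tt⁻¹ ^ (n - 1)) i) = 0 := by
        rw [Ci, map_mul, map_mul, map_prod]
        rw [Finset.prod_eq_zero (Finset.mem_erase.2 ⟨hij, Finset.mem_univ j⟩)]
        · simp
        · rw [map_sub, map_mul, eval_X, eval_X, eval_C]
          change qq ^ cext ν i * tt⁻¹ ^ (i : ℕ) - tt * (qq ^ cext ν j * tt⁻¹ ^ ((i : ℕ) + 1)) = 0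
          rw [cext_fin, cext_fin, he, pow_succ]
          have := tt_ne
          field_simp
          ring
      rw [this, zero_mul]
    · have hle := hν i j (by rw [Fin.le_def, hj]; simp)
      have h0 : ν i ≠ 0 := by omega
      rw [lower_eq _ _ h0, h, mul_zero]
      · intro a b hab
        by_cases ha : a = i
        · subst ha
          by_cases hb : b = a
          · rw [hb]
          · rw [Function.update_of_ne hb, Function.update_self]
            have : ν b ≤ ν j := hν j b (by
              have : (a : ℕ) < b := lt_of_le_of_ne hab (fun h => hb (Fin.ext h.symm))
              rw [Fin.le_def, hj]; exact this)
            omega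
        · rw [Function.update_of_ne ha]
          refine le_trans ?_ (hν a b hab)
          by_cases hb : b = i
          · subst hb; rw [Function.update_self]; omega
          · rw [Function.update_of_ne hb]
      · have := lower_csize ν i h0; omega
      · intro he
        have := lower_csize ν i h0
        rw [he] at this; omega

theorem hp_inj {n : ℕ} (ν : Fin n → ℕ) : Function.Injective (hp ν) :=
  fun _ _ h => Fin.ext (hpt_inj ν h)

theorem eigen_eval {n : ℕ} (l ν : Fin n → ℕ) (hν : IsPartition ν) (hs : csize ν ≤ csize l)
    (f : MvPolynomial (Fin n) K)
    (h : ∀ ν : Fin n → ℕ, IsPartition ν → csize ν ≤ csize l → ν ≠ l → eval (hp ν) f = 0) :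
    eval (hp ν) (NN qq⁻¹ tt (tt⁻¹ ^ (n - 1)) f) =
      ceig qq⁻¹ tt ν * eval (hp ν) (D2 K n) * eval (hp ν) f := by
  rcases Nat.eq_zero_or_pos n with hn | hn
  · subst hn; simp [NN, ceig]
  apply mul_left_cancel₀ qinv_ne
  set x := hp ν with hx
  have hx0 : ∀ i, x i ≠ 0 := fun i => hpt_ne ν i
  have hxi : Function.Injective x := hp_inj ν
  have hl := lag_main x hxi hx0 hn tt (tt⁻¹ ^ (n - 1)) tt_ne tt_ne_one
  have hsub : ∀ i, ∀ j ∈ Finset.univ.erase i, x i - x j ≠ 0 := fun i j hj =>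
    sub_ne_zero.2 (fun h => (Finset.ne_of_mem_erase hj) (hxi h).symm)
  have h1 : ∀ i, (1 - qq⁻¹) * (eval x (Ci tt (tt⁻¹ ^ (n - 1)) i) * eval x (qd qq⁻¹ i f)) =
      ((x i - tt⁻¹ ^ (n - 1)) * (∏ j ∈ Finset.univ.erase i, (x i - tt * x j)) /
        (x i * ∏ j ∈ Finset.univ.erase i, (x i - x j))) * (eval x (D2 K n) * eval x f) := by
    intro i
    have h2 := eigen_term l ν hν hs f h i
    have h3 := qd_eval qq⁻¹ i f x
    rw [← hx] at h2
    have h4 : x i * ((1 - qq⁻¹) * (eval x (Ci tt (tt⁻¹ ^ (n - 1)) i) * eval x (qd qq⁻¹ i f))) =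
        eval x (Ci tt (tt⁻¹ ^ (n - 1)) i) * eval x f := by
      linear_combination (eval x (Ci tt (tt⁻¹ ^ (n - 1)) i)) * h3 - h2
    apply mul_left_cancel₀ (hx0 i)
    rw [h4, D2_eq i, Ci]
    simp only [map_mul, map_prod, map_sub, eval_X, eval_C]
    have hne : ∏ j ∈ Finset.univ.erase i, (x i - x j) ≠ 0 := Finset.prod_ne_zero_iff.2 (hsub i)
    have := hx0 i
    field_simp
  rw [NN, map_sum, Finset.mul_sum]
  simp only [map_mul]
  rw [Finset.sum_congr rfl fun i _ => h1 i, ← Finset.sum_mul, hl]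
  have h5 : (1 - qq⁻¹) * ceig qq⁻¹ tt ν = ∑ i ∈ Finset.range n, tt ^ i - tt⁻¹ ^ (n - 1) * tt ^ (n - 1) * ∑ i, (x i)⁻¹ := by
    rw [← mul_pow, inv_mul_cancel₀ tt_ne, one_pow, one_mul, Finset.sum_range, ← Finset.sum_sub_distrib, ceig, Finset.mul_sum]
    refine Finset.sum_congr rfl fun i _ => ?_
    rw [mul_left_comm, br_mul, hx, hp, hpt, cext_fin]
    rw [mul_inv, inv_pow, inv_pow, inv_inv]; ring
  rw [← h5]; ring

theorem eigen_main {n : ℕ} (l : Fin n → ℕ) 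
    (f : MvPolynomial (Fin n) K) (hf : f.IsSymmetric) (hd : f.totalDegree ≤ csize l)
    (h : ∀ ν : Fin n → ℕ, IsPartition ν → csize ν ≤ csize l → ν ≠ l → eval (hp ν) f = 0) :
    NN qq⁻¹ tt (tt⁻¹ ^ (n - 1)) f = C (ceig qq⁻¹ tt l) * D2 K n * f := by
  obtain ⟨g, hg1, hg2, hg3⟩ := NN_quot qq⁻¹ tt (tt⁻¹ ^ (n - 1)) f hf
  have : g - C (ceig qq⁻¹ tt l) * f = 0 := by
    apply nondeg (d := csize l)
    · exact hg2.sub ((IsSymmetric.C _).mul hf)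
    · refine (totalDegree_sub _ _).trans (max_le (hg3.trans hd) ((totalDegree_mul _ _).trans ?_))
      rw [totalDegree_C, zero_add]; exact hd
    · intro ν hν hs
      have h1 := eigen_eval l ν hν hs f h
      rw [hg1, map_mul] at h1
      have hD : eval (hp ν) (D2 K n) ≠ 0 := by
        simp only [D2, map_prod, map_sub, eval_X]
        refine Finset.prod_ne_zero_iff.2 fun i _ => Finset.prod_ne_zero_iff.2 fun j hj =>
          sub_ne_zero.2 (fun h => (Finset.ne_of_mem_erase hj) (hp_inj ν h).symm)
      have h2 : eval (hp ν) g = ceig qq⁻¹ tt ν * eval (hp ν) f := by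
        apply mul_left_cancel₀ hD
        rw [h1]; ring
      rw [map_sub, map_mul, eval_C, h2]
      by_cases hνl : ν = l
      · rw [hνl]; ring
      · rw [h ν hν hs hνl]; ring
  rw [hg1, sub_eq_zero.1 this]; ring

/-! ### Part F : regularity at `q = 1` as a ring -/

/-- the ring `ℚ[q,t]` -/
abbrev Aqt : Type := MvPolynomial (Fin 2) ℚ

theorem alg_ne {b : Aqt} (hb : b ≠ 0) : algebraMap Aqt K b ≠ 0 := by
  rw [Ne, FaithfulSMul.algebraMap_eq_zero_iff]; exact hb

theorem reg_of (a : Aqt) : RegAtQ1 (algebraMap Aqt K a) (specQ1 a) :=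
  ⟨a, 1, one_ne_zero, by simp, by simp, by simp⟩

theorem reg_add {c c' : K} {v v' : K1} (h : RegAtQ1 c v) (h' : RegAtQ1 c' v') :
    RegAtQ1 (c + c') (v + v') := by
  obtain ⟨a, b, hb, hb1, rfl, rfl⟩ := h
  obtain ⟨a', b', hb', hb1', rfl, rfl⟩ := h'
  refine ⟨a * b' + b * a', b * b', mul_ne_zero hb hb', ?_, ?_, ?_⟩
  · rw [map_mul]; exact mul_ne_zero hb1 hb1'
  · simp only [map_mul, map_add]; rw [div_add_div _ _ (alg_ne hb) (alg_ne hb')]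
  · simp only [map_mul, map_add]; rw [div_add_div _ _ hb1 hb1']

theorem reg_mul {c c' : K} {v v' : K1} (h : RegAtQ1 c v) (h' : RegAtQ1 c' v') :
    RegAtQ1 (c * c') (v * v') := by
  obtain ⟨a, b, hb, hb1, rfl, rfl⟩ := h
  obtain ⟨a', b', hb', hb1', rfl, rfl⟩ := h'
  refine ⟨a * a', b * b', mul_ne_zero hb hb', ?_, ?_, ?_⟩
  · rw [map_mul]; exact mul_ne_zero hb1 hb1'
  · simp only [map_mul]; rw [div_mul_div_comm]
  · simp only [map_mul]; rw [div_mul_div_comm]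

theorem reg_neg {c : K} {v : K1} (h : RegAtQ1 c v) : RegAtQ1 (-c) (-v) := by
  obtain ⟨a, b, hb, hb1, rfl, rfl⟩ := h
  exact ⟨-a, b, hb, hb1, by rw [map_neg, neg_div], by rw [map_neg, neg_div]⟩

theorem reg_inv {c : K} {v : K1} (h : RegAtQ1 c v) (hv : v ≠ 0) : RegAtQ1 c⁻¹ v⁻¹ := by
  obtain ⟨a, b, hb, hb1, rfl, rfl⟩ := h
  have ha : specQ1 a ≠ 0 := fun h => hv (by rw [h, zero_div])
  exact ⟨b, a, fun h => ha (by rw [h, map_zero]), ha, by rw [inv_div], by rw [inv_div]⟩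

theorem reg_unique {c : K} {v v' : K1} (h : RegAtQ1 c v) (h' : RegAtQ1 c v') : v = v' := by
  obtain ⟨a, b, hb, hb1, rfl, rfl⟩ := h
  obtain ⟨a', b', hb', hb1', h2, rfl⟩ := h'
  rw [div_eq_div_iff (alg_ne hb) (alg_ne hb'), ← map_mul, ← map_mul] at h2
  have h3 := FaithfulSMul.algebraMap_injective _ _ h2
  rw [div_eq_div_iff hb1 hb1', ← map_mul, ← map_mul, h3]

/-- the ring of elements regular at `q = 1`, with their values -/
def Rsub : Subring (K × K1) where
  carrier := {z | RegAtQ1 z.1 z.2}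
  mul_mem' h h' := reg_mul h h'
  add_mem' h h' := reg_add h h'
  neg_mem' h := reg_neg h
  zero_mem' := by simpa using reg_of 0
  one_mem' := by simpa using reg_of 1

theorem mem_Rsub {z : K × K1} : z ∈ Rsub ↔ RegAtQ1 z.1 z.2 := Iff.rfl

/-- inclusion in `K` -/
def phi : Rsub →+* K := (RingHom.fst K K1).comp Rsub.subtype
/-- specialization -/
def psi : Rsub →+* K1 := (RingHom.snd K K1).comp Rsub.subtype

theorem phi_inj : Function.Injective phi := by
  rintro ⟨⟨c, v⟩, h⟩ ⟨⟨c', v'⟩, h'⟩ he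
  have h1 : c = c' := he
  subst h1
  have := reg_unique h h'
  simp only at this
  subst this
  rfl

theorem reg_phi_psi (z : Rsub) : RegAtQ1 (phi z) (psi z) := z.2

/-- polynomials are regular -/
def iota : Aqt →+* Rsub := ((algebraMap Aqt K).prod specQ1).codRestrict Rsub (fun a => reg_of a)

theorem phi_iota (a : Aqt) : phi (iota a) = algebraMap Aqt K a := rfl
theorem psi_iota (a : Aqt) : psi (iota a) = specQ1 a := rfl

theorem specQ1_X0 : specQ1 (X 0) = 1 := by simp [specQ1]
theorem specQ1_X1 : specQ1 (X 1) = t1 := by simp [specQ1]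
theorem t1_ne : t1 ≠ 0 := by
  rw [t1, Ne, FaithfulSMul.algebraMap_eq_zero_iff]; exact Polynomial.X_ne_zero
theorem reg_qinv : RegAtQ1 qq⁻¹ 1 := by
  have := reg_inv (reg_of (X 0)) (by rw [specQ1_X0]; exact one_ne_zero)
  rwa [specQ1_X0, inv_one] at this
theorem reg_tt : RegAtQ1 tt t1 := by
  have := reg_of (X 1)
  rwa [specQ1_X1] at this
theorem reg_ttinv : RegAtQ1 tt⁻¹ t1⁻¹ := reg_inv reg_tt t1_ne

/-- `1/q` -/
def pR : Rsub := ⟨(qq⁻¹, 1), reg_qinv⟩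
/-- `t` -/
def tR : Rsub := ⟨(tt, t1), reg_tt⟩
/-- `1/t` -/
def uR : Rsub := ⟨(tt⁻¹, t1⁻¹), reg_ttinv⟩

theorem phi_pR : phi pR = qq⁻¹ := rfl
theorem phi_tR : phi tR = tt := rfl
theorem phi_uR : phi uR = tt⁻¹ := rfl
theorem psi_pR : psi pR = 1 := rfl
theorem psi_tR : psi tR = t1 := rfl
theorem psi_uR : psi uR = t1⁻¹ := rfl

theorem spec_zero_dvd (a : Aqt) (h : specQ1 a = 0) : (X 0 - 1 : Aqt) ∣ a := by
  let e1 : Aqt →ₐ[ℚ] Polynomial ℚ := aeval (fun i : Fin 2 => if i = 0 then 1 else Polynomial.X)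
  have h1 : algebraMap (Polynomial ℚ) K1 (e1 a) = specQ1 a := by
    have : (IsScalarTower.toAlgHom ℚ (Polynomial ℚ) K1).comp e1 =
        (MvPolynomial.aeval (fun i : Fin 2 => if i = 0 then (1 : K1) else t1)) := by
      ext i
      simp only [AlgHom.comp_apply, aeval_X, e1]
      split_ifs
      · simp
      · rfl
    exact DFunLike.congr_fun this a
  rw [h, FaithfulSMul.algebraMap_eq_zero_iff] at h1
  let e2 : Polynomial ℚ →ₐ[ℚ] Aqt := Polynomial.aeval (X 1)
  set I := Ideal.span {(X 0 - 1 : Aqt)} with hI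
  have h0 : Ideal.Quotient.mk I (X 0) = Ideal.Quotient.mk I 1 := by
    rw [Ideal.Quotient.eq, hI]; exact Ideal.mem_span_singleton_self _
  have h2 : (Ideal.Quotient.mkₐ ℚ I) = ((Ideal.Quotient.mkₐ ℚ I).comp e2).comp e1 := by
    ext i
    simp only [AlgHom.comp_apply, Ideal.Quotient.mkₐ_eq_mk, e1, e2, aeval_X]
    fin_cases i
    · simpa using h0
    · simp
  have h3 := DFunLike.congr_fun h2 a
  simp only [AlgHom.comp_apply, h1, map_zero] at h3
  rw [← Ideal.mem_span_singleton, ← hI, ← Ideal.Quotient.eq_zero_iff_mem]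
  exact h3

theorem not_unit_X0 : ¬ IsUnit (X 0 - 1 : Aqt) := by
  intro h
  have := h.map specQ1
  rw [map_sub, specQ1_X0, map_one, sub_self] at this
  exact not_isUnit_zero this

theorem exists_reduction {n : ℕ} (f : MvPolynomial (Fin n) K) (hf : f ≠ 0) :
    ∃ (c : K) (F : MvPolynomial (Fin n) Rsub), c ≠ 0 ∧ map phi F = C c * f ∧ map psi F ≠ 0 := by
  obtain ⟨d, hd⟩ := IsLocalization.exist_integer_multiples_of_finset (nonZeroDivisors Aqt)
    (f.support.image (fun m => coeff m f))
  have hd0 : (d : Aqt) ≠ 0 := nonZeroDivisors.coe_ne_zero d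
  have hG : ∃ G : MvPolynomial (Fin n) Aqt, map (algebraMap Aqt K) G = C (algebraMap Aqt K d) * f := by
    have : ∀ m, ∃ a : Aqt, algebraMap Aqt K a = algebraMap Aqt K d * coeff m f := by
      intro m
      by_cases hm : m ∈ f.support
      · obtain ⟨a, ha⟩ := hd _ (Finset.mem_image_of_mem _ hm)
        exact ⟨a, by rw [ha, Algebra.smul_def]⟩
      · exact ⟨0, by rw [notMem_support_iff.1 hm]; simp⟩
    choose a ha using this
    refine ⟨∑ m ∈ f.support, monomial m (a m), ?_⟩
    rw [map_sum]
    conv_rhs => rw [f.as_sum, Finset.mul_sum]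
    refine Finset.sum_congr rfl fun m _ => ?_
    rw [map_monomial, ha, C_mul_monomial]
  obtain ⟨G, hG⟩ := hG
  have hG0 : G ≠ 0 := by
    rintro rfl
    rw [map_zero] at hG
    exact (mul_ne_zero (C_ne_zero.2 (alg_ne hd0)) hf) hG.symm
  have hfin : FiniteMultiplicity (C (X 0 - 1 : Aqt) : MvPolynomial (Fin n) Aqt) G := by
    apply FiniteMultiplicity.of_not_isUnit _ hG0
    intro h
    have h2 := h.map (eval (fun _ : Fin n => (0 : Aqt)))
    rw [eval_C] at h2
    exact not_unit_X0 h2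
  obtain ⟨G', hG1, hG2⟩ := hfin.exists_eq_pow_mul_and_not_dvd
  set k := multiplicity (C (X 0 - 1 : Aqt) : MvPolynomial (Fin n) Aqt) G
  have hpi : (X 0 - 1 : Aqt) ≠ 0 := by
    intro h
    have := congrArg (eval (fun _ : Fin 2 => (0 : ℚ))) h
    simp at this
  set w := algebraMap Aqt K (X 0 - 1) with hw
  have hw0 : w ≠ 0 := alg_ne hpi
  refine ⟨(w ^ k)⁻¹ * algebraMap Aqt K d, map iota G', ?_, ?_, ?_⟩
  · exact mul_ne_zero (inv_ne_zero (pow_ne_zero _ hw0)) (alg_ne hd0)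
  · rw [map_map, show phi.comp iota = algebraMap Aqt K from rfl]
    rw [hG1, map_mul, map_pow, map_C, ← hw] at hG
    rw [C_mul, mul_assoc, ← hG, ← mul_assoc, ← C_pow, ← C_mul, inv_mul_cancel₀ (pow_ne_zero _ hw0), C_1, one_mul]
  · rw [map_map, show psi.comp iota = specQ1 from rfl]
    intro h0
    apply hG2
    rw [C_dvd_iff_dvd_coeff]
    intro m
    apply spec_zero_dvd
    rw [← coeff_map, h0, coeff_zero]

/-! ### Part G : the eigenvalue problem at `q = 1` -/

theorem ceig_map {R S : Type*} [CommRing R] [CommRing S] {n : ℕ} (φ : R →+* S) (p t : R) (l : Fin n → ℕ) :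
    φ (ceig p t l) = ceig (φ p) (φ t) l := by
  simp [ceig, br_map]

/-- eigenvector of the `q = 1` operator -/
def IsEig {n : ℕ} (γ : K1) (w : MvPolynomial (Fin n) K1) : Prop :=
  NN 1 t1 (t1⁻¹ ^ (n - 1)) w = C γ * D2 K1 n * w

theorem transfer {n : ℕ} (F : MvPolynomial (Fin n) Rsub) (l : Fin n → ℕ)
    (h : NN qq⁻¹ tt (tt⁻¹ ^ (n - 1)) (map phi F) = C (ceig qq⁻¹ tt l) * D2 K n * map phi F) :
    IsEig (ceig 1 t1 l) (map psi F) := by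
  have h1 : NN pR tR (uR ^ (n - 1)) F = C (ceig pR tR l) * D2 Rsub n * F := by
    apply map_injective phi phi_inj
    rw [NN_map, map_mul, map_mul, map_C, D2_map, ceig_map, map_pow, phi_pR, phi_tR, phi_uR, h]
  have h2 := congrArg (map psi) h1
  rw [NN_map, map_mul, map_mul, map_C, D2_map, ceig_map, map_pow, psi_pR, psi_tR, psi_uR] at h2
  exact h2

theorem eig_mul {n : ℕ} {γ γ' : K1} {v w : MvPolynomial (Fin n) K1} (h : IsEig γ v) (h' : IsEig γ' w) :
    IsEig (γ + γ') (v * w) := by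
  rw [IsEig] at *
  rw [NN_one_mul, h, h', C_add]; ring

theorem eig_one {n : ℕ} : IsEig 0 (1 : MvPolynomial (Fin n) K1) := by
  simp [IsEig, NN, qd_one]

theorem eig_smul {n : ℕ} {γ : K1} (c : K1) {v : MvPolynomial (Fin n) K1} (h : IsEig γ v) :
    IsEig γ (C c * v) := by
  rw [IsEig] at *
  rw [NN_smul, h]; ring

theorem eig_sub {n : ℕ} {γ : K1} {v w : MvPolynomial (Fin n) K1} (h : IsEig γ v) (h' : IsEig γ w) :
    IsEig γ (v - w) := by
  have h2 := eig_smul (-1) h'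
  rw [IsEig] at *
  have : v - w = v + C (-1) * w := by rw [C_neg, C_1]; ring
  rw [this, NN_add, h, h2]; ring

theorem eig_pow {n : ℕ} {γ : K1} {v : MvPolynomial (Fin n) K1} (h : IsEig γ v) (k : ℕ) :
    IsEig (k * γ) (v ^ k) := by
  induction k with
  | zero => simpa using eig_one
  | succ k ih =>
    rw [pow_succ]
    convert eig_mul ih h using 1
    push_cast; ring

theorem eig_prod {n : ℕ} {ι : Type*} (s : Finset ι) (γ : ι → K1) (v : ι → MvPolynomial (Fin n) K1)
    (h : ∀ i ∈ s, IsEig (γ i) (v i)) : IsEig (∑ i ∈ s, γ i) (∏ i ∈ s, v i) := by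
  induction s using Finset.induction_on with
  | empty => simpa using eig_one
  | insert b s hb ih =>
    rw [Finset.sum_insert hb, Finset.prod_insert hb]
    exact eig_mul (h b (Finset.mem_insert_self _ _)) (ih fun i hi => h i (Finset.mem_insert_of_mem hi))

theorem NN_zero {n : ℕ} {R : Type*} [CommRing R] (p t s : R) : NN p t s (0 : MvPolynomial (Fin n) R) = 0 := by
  simp [NN]

theorem NN_sum {n : ℕ} {R ι : Type*} [CommRing R] (p t s : R) (S : Finset ι) (w : ι → MvPolynomial (Fin n) R) :
    NN p t s (∑ i ∈ S, w i) = ∑ i ∈ S, NN p t s (w i) := by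
  induction S using Finset.induction_on with
  | empty => simp [NN_zero]
  | insert b s hb ih => rw [Finset.sum_insert hb, Finset.sum_insert hb, NN_add, ih]

theorem eig_indep {n : ℕ} {ι : Type*} (S : Finset ι) (γ : ι → K1) (hγ : Function.Injective γ)
    (w : ι → MvPolynomial (Fin n) K1) (h : ∀ i ∈ S, IsEig (γ i) (w i)) (h0 : ∑ i ∈ S, w i = 0) :
    ∀ i ∈ S, w i = 0 := by
  induction S using Finset.induction_on generalizing w with
  | empty => simp
  | insert b S hb ih =>
    have h1 : ∑ i ∈ insert b S, C (γ i) * w i = 0 := by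
      have := congrArg (NN 1 t1 (t1⁻¹ ^ (n - 1))) h0
      rw [NN_sum, NN_zero, Finset.sum_congr rfl h] at this
      apply mul_left_cancel₀ (D2_ne (F := K1) (n := n))
      rw [mul_zero, ← this, Finset.mul_sum]
      exact Finset.sum_congr rfl fun i _ => by ring
    have h2 : ∑ i ∈ S, C (γ i - γ b) * w i = 0 := by
      rw [Finset.sum_insert hb] at h1 h0
      simp only [C_sub, sub_mul, Finset.sum_sub_distrib, ← Finset.mul_sum]
      linear_combination h1 - C (γ b) * h0
    have h3 := ih (fun i => C (γ i - γ b) * w i)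
      (fun i hi => eig_smul _ (h i (Finset.mem_insert_of_mem hi))) h2
    have h4 : ∀ i ∈ S, w i = 0 := by
      intro i hi
      have := h3 i hi
      rcases mul_eq_zero.1 this with h5 | h5
      · rw [C_eq_zero, sub_eq_zero] at h5
        exact absurd (hγ h5) (fun h => hb (h ▸ hi))
      · exact h5
    intro i hi
    rw [Finset.mem_insert] at hi
    rcases hi with rfl | hi
    · rwa [Finset.sum_insert hb, Finset.sum_eq_zero h4, add_zero] at h0
    · exact h4 i hi

/-! #### the elementary functions are eigenvectors -/

/-- parameters over the regular ring -/
def aR (n : ℕ) (j : ℕ) : Rsub := tR ^ j * uR ^ (n - 1)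

theorem estar_eq (n k : ℕ) : estarElem1 n k = map psi (facP n k (aR n)) := by
  rw [facP_map, facP_eq_sum, estarElem1]
  simp only [aR, map_mul, map_pow, psi_tR, psi_uR, inv_pow, div_eq_mul_inv]

/-- the column partition -/
def colp (n k : ℕ) : Fin n → ℕ := fun i => if (i : ℕ) < k then 1 else 0

theorem csize_colp {n k : ℕ} (hk : k ≤ n) : csize (colp n k) = k := by
  rw [csize]
  simp only [colp, Finset.sum_boole, Nat.cast_id]
  rw [Fin.card_filter_val_lt]; omega

theorem colp_vanish {n k : ℕ} (hk : k + 1 ≤ n) (ν : Fin n → ℕ) (hν : IsPartition ν)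
    (hs : csize ν ≤ csize (colp n (k + 1))) (hne : ν ≠ colp n (k + 1)) : cext ν k = 0 := by
  rw [csize_colp hk] at hs
  by_contra h0
  apply hne
  have h1 : ∀ i ∈ Finset.univ, colp n (k + 1) i ≤ ν i := by
    intro i _
    rw [colp]
    split_ifs with h
    · have := cext_anti hν (by omega : (i : ℕ) ≤ k)
      rw [cext_fin] at this; omega
    · omega
  have h2 : csize (colp n (k + 1)) = csize ν := by
    apply le_antisymm
    · exact Finset.sum_le_sum h1
    · rw [csize_colp hk]; exact hs
  have h3 := (Finset.sum_eq_sum_iff_of_le h1).1 h2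
  funext i
  exact (h3 i (Finset.mem_univ i)).symm

theorem estar_eig {n k : ℕ} (hk : k + 1 ≤ n) :
    IsEig (∑ r ∈ Finset.range (k + 1), t1 ^ r) (estarElem1 n (k + 1)) := by
  rw [estar_eq]
  have h : ceig 1 t1 (colp n (k + 1)) = ∑ r ∈ Finset.range (k + 1), t1 ^ r := by
    rw [ceig]
    have : ∀ i : Fin n, t1 ^ (i : ℕ) * br 1 (colp n (k + 1) i) = (fun r => if r < k + 1 then t1 ^ r else 0) (i : ℕ) := by
      intro i
      simp only [colp]
      split_ifs <;> simp [br]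
    rw [Finset.sum_congr rfl fun i _ => this i, ← Finset.sum_range (fun r => if r < k + 1 then t1 ^ r else 0),
      ← Finset.sum_filter]
    refine Finset.sum_congr ?_ fun _ _ => rfl
    ext r; simp; omega
  rw [← h]
  apply transfer
  have hp1 : map phi (facP n (k + 1) (aR n)) = facP n (k + 1) (fun j => tt ^ j * tt⁻¹ ^ (n - 1)) := by
    rw [facP_map]; simp only [aR, map_mul, map_pow, phi_tR, phi_uR]
  have ha : ∀ i, i < n → tt ^ (n - 1 - i) * tt⁻¹ ^ (n - 1) = tt⁻¹ ^ i := by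
    intro i hi
    have := tt_ne
    rw [show n - 1 = (n - 1 - i) + i by omega, show n - 1 - i + i - i = n - 1 - i by omega, pow_add,
      ← mul_assoc, ← mul_pow, mul_inv_cancel₀ tt_ne, one_pow, one_mul]
  rw [hp1]
  apply eigen_main
  · exact facP_symm _ _ hk _
  · rw [csize_colp hk]; exact facP_totalDegree _ _ _
  · intro ν hν hs hne
    have h0 := colp_vanish hk ν hν hs hne
    have hz : ∀ i, k ≤ i → hpt ν i = tt⁻¹ ^ i := by
      intro i hi
      have := cext_anti hν hi
      rw [hpt, show cext ν i = 0 by omega, pow_zero, one_mul]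
    change eval (fun i : Fin n => hpt ν i) _ = 0
    rw [facP_eval_tail n (k + 1) hk]
    · apply Finset.prod_eq_zero (Finset.mem_range.2 (Nat.lt_succ_self k))
      rw [hz k le_rfl, show n - (k + 1) = n - 1 - k by omega, ha k (by omega), sub_self]
    · intro i h1 h2
      rw [hz i (by omega), ha i h2]

/-- monomials in the `e*` -/
def evec {n : ℕ} (a : Fin n →₀ ℕ) : MvPolynomial (Fin n) K1 := ∏ i : Fin n, estarElem1 n (i + 1) ^ a i

/-- polynomial eigenvalue -/
def gamP {n : ℕ} (a : Fin n →₀ ℕ) : Polynomial ℚ :=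
  ∑ i : Fin n, (a i : Polynomial ℚ) * ∑ r ∈ Finset.range ((i : ℕ) + 1), Polynomial.X ^ r

/-- eigenvalue -/
def gam {n : ℕ} (a : Fin n →₀ ℕ) : K1 :=
  ∑ i : Fin n, (a i : K1) * ∑ r ∈ Finset.range ((i : ℕ) + 1), t1 ^ r

theorem gam_eq {n : ℕ} (a : Fin n →₀ ℕ) : gam a = algebraMap (Polynomial ℚ) K1 (gamP a) := by
  simp only [gam, gamP, map_sum, map_mul, map_pow, map_natCast, t1]

theorem evec_eig {n : ℕ} (a : Fin n →₀ ℕ) : IsEig (gam a) (evec a) :=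
  eig_prod _ _ _ fun i _ => eig_pow (estar_eig i.2) _

theorem gamP_coeff {n : ℕ} (a : Fin n →₀ ℕ) (r : ℕ) :
    (gamP a).coeff r = ((∑ i : Fin n, if r ≤ (i : ℕ) then a i else 0 : ℕ) : ℚ) := by
  rw [gamP, Polynomial.finsetSum_coeff, Nat.cast_sum]
  refine Finset.sum_congr rfl fun i _ => ?_
  rw [← Polynomial.C_eq_natCast, Polynomial.coeff_C_mul, Polynomial.finsetSum_coeff]
  simp only [Polynomial.coeff_X_pow]
  simp [Nat.lt_succ_iff]

theorem gam_inj {n : ℕ} : Function.Injective (gam (n := n)) := by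
  intro a b h
  rw [gam_eq, gam_eq] at h
  have h1 := FaithfulSMul.algebraMap_injective _ _ h
  have h2 : ∀ r : ℕ, (∑ i : Fin n, if r ≤ (i : ℕ) then a i else 0 : ℕ) = ∑ i : Fin n, if r ≤ (i : ℕ) then b i else 0 := by
    intro r
    have := congrArg (fun P => P.coeff r) h1
    simp only [gamP_coeff] at this
    exact_mod_cast this
  have h3 : ∀ (c : Fin n →₀ ℕ) (j : Fin n), (∑ i : Fin n, if (j : ℕ) ≤ (i : ℕ) then c i else 0 : ℕ) =
      c j + ∑ i : Fin n, if (j : ℕ) + 1 ≤ (i : ℕ) then c i else 0 := by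
    intro c j
    have : c j = ∑ i : Fin n, if i = j then c i else 0 := by simp
    rw [this, ← Finset.sum_add_distrib]
    refine Finset.sum_congr rfl fun i _ => ?_
    by_cases hij : i = j
    · subst hij; simp
    · have : (i : ℕ) ≠ j := fun h => hij (Fin.ext h)
      rw [if_neg hij, zero_add]
      congr 1
      simp only [eq_iff_iff]; omega
  ext j
  have h4 := h2 j
  rw [h3, h3, h2 (j + 1)] at h4
  omega

/-- the substitution homomorphism -/
def eHom (n : ℕ) : MvPolynomial (Fin n) K1 →ₐ[K1] MvPolynomial (Fin n) K1 :=
  aeval (fun i : Fin n => estarElem1 n (i + 1))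

theorem esymm_mem (n k : ℕ) (hk : k ≤ n) : esymm (Fin n) K1 k ∈ (eHom n).range := by
  induction k using Nat.strong_induction_on with
  | _ k ih =>
    cases k with
    | zero => rw [esymm_zero]; exact one_mem _
    | succ k =>
      have h1 : estarElem1 n (k + 1) ∈ (eHom n).range := ⟨X ⟨k, hk⟩, by simp [eHom]⟩
      have h2 := facP_expand n (k + 1) hk (fun i => psi (aR n i))
      rw [← facP_map, ← estar_eq, Finset.sum_range_succ, Nat.sub_self, pow_zero, one_mul] at h2
      have h3 : facH (fun i => psi (aR n i)) 0 (n + 1 - (k + 1)) = 1 := by simp [facH]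
      rw [h3, C_1, one_mul] at h2
      rw [← sub_eq_iff_eq_add'] at h2
      rw [← h2]
      refine Subalgebra.sub_mem _ h1 (Subalgebra.sum_mem _ fun j hj => Subalgebra.mul_mem _ ?_ ?_)
      · exact Subalgebra.algebraMap_mem _ _
      · rw [Finset.mem_range] at hj
        exact ih j hj (by omega)

theorem symm_mem (n : ℕ) (g : MvPolynomial (Fin n) K1) (hg : g.IsSymmetric) : g ∈ (eHom n).range := by
  obtain ⟨Q, hQ⟩ := esymmAlgHom_fin_surjective (R := K1) (le_refl n) ⟨g, hg⟩
  have h1 := congrArg Subtype.val hQ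
  rw [esymmAlgHom_apply] at h1
  simp only at h1
  rw [← h1]
  have : (aeval (fun i : Fin n => esymm (Fin n) K1 ((i : ℕ) + 1)) Q) ∈
      (aeval (R := K1) (fun i : Fin n => esymm (Fin n) K1 ((i : ℕ) + 1))).range := ⟨Q, rfl⟩
  rw [← Algebra.adjoin_range_eq_range_aeval] at this
  refine Algebra.adjoin_le ?_ this
  rintro _ ⟨i, rfl⟩
  exact esymm_mem n _ i.2

theorem eig_unique {n : ℕ} (g : MvPolynomial (Fin n) K1) (hg : g.IsSymmetric) (a : Fin n →₀ ℕ)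
    (h : IsEig (gam a) g) : ∃ κ : K1, g = C κ * evec a := by
  obtain ⟨P, hP⟩ := symm_mem n g hg
  have hP1 : g = ∑ b ∈ P.support, C (coeff b P) * evec b := by
    have hP2 : eHom n P = g := hP
    rw [← hP2, eHom, aeval_def, eval₂_eq']
    rfl
  set S := insert a P.support with hS
  have hP3 : g = ∑ b ∈ S, C (coeff b P) * evec b := by
    rw [hP1]
    apply Finset.sum_subset (Finset.subset_insert _ _)
    intro b _ hb
    rw [notMem_support_iff.1 hb, C_0, zero_mul]
  refine ⟨coeff a P, ?_⟩
  have := eig_indep S gam gam_inj (fun b => C (coeff b P) * evec b - if b = a then g else 0) ?_ ?_ a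
    (Finset.mem_insert_self _ _)
  · simp only [if_true] at this
    exact (sub_eq_zero.1 this).symm
  · intro b _
    by_cases hb : b = a
    · subst hb
      simp only [if_true]
      exact eig_sub (eig_smul _ (evec_eig b)) h
    · simp only [if_neg hb, sub_zero]
      exact eig_smul _ (evec_eig b)
  · rw [Finset.sum_sub_distrib, ← hP3, Finset.sum_ite_eq' S a, if_pos (Finset.mem_insert_self _ _), sub_self]

/-! ### Part H : leading terms and conclusion -/

/-- weight of an exponent -/
def wt {n : ℕ} (m : Fin n →₀ ℕ) : ℕ := ∑ i : Fin n, (n - (i : ℕ)) * m i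

theorem wt_add {n : ℕ} (a b : Fin n →₀ ℕ) : wt (a + b) = wt a + wt b := by
  simp [wt, mul_add, Finset.sum_add_distrib]

theorem wt_single {n : ℕ} (i : Fin n) : wt (Finsupp.single i 1) = n - (i : ℕ) := by
  rw [wt, Finset.sum_eq_single i]
  · simp
  · intro b _ hb
    simp [Finsupp.single_apply, hb.symm]
  · simp

/-- `x^m0` is the leading term, with coefficient one -/
def TopAt {n : ℕ} (f : MvPolynomial (Fin n) K1) (m0 : Fin n →₀ ℕ) : Prop :=
  coeff m0 f = 1 ∧ ∀ m, coeff m f ≠ 0 → m ≠ m0 → wt m < wt m0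

theorem topAt_one {n : ℕ} : TopAt (1 : MvPolynomial (Fin n) K1) 0 := by
  constructor
  · simp
  · intro m hm hm0
    rw [coeff_one] at hm
    simp [hm0.symm] at hm

theorem topAt_mul {n : ℕ} {f g : MvPolynomial (Fin n) K1} {a b : Fin n →₀ ℕ} (hf : TopAt f a) (hg : TopAt g b) :
    TopAt (f * g) (a + b) := by
  have key : ∀ x y, coeff x f * coeff y g ≠ 0 → (x, y) ≠ (a, b) → wt (x + y) < wt (a + b) := by
    intro x y h hne
    have h1 := left_ne_zero_of_mul h
    have h2 := right_ne_zero_of_mul h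
    rw [wt_add, wt_add]
    by_cases hx : x = a
    · by_cases hy : y = b
      · exact absurd (by rw [hx, hy]) hne
      · have := hg.2 y h2 hy
        rw [hx]; omega
    · have := hf.2 x h1 hx
      by_cases hy : y = b
      · rw [hy]; omega
      · have := hg.2 y h2 hy
        omega
  constructor
  · rw [coeff_mul, Finset.sum_eq_single (a, b)]
    · rw [hf.1, hg.1, one_mul]
    · rintro ⟨x, y⟩ hxy hne
      by_contra h
      have := key x y h hne
      rw [Finset.HasAntidiagonal.mem_antidiagonal] at hxy
      simp only at hxy
      rw [hxy] at this
      omega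
    · intro h
      exact absurd (by rw [Finset.HasAntidiagonal.mem_antidiagonal]) h
  · intro m hm hne
    rw [coeff_mul] at hm
    obtain ⟨⟨x, y⟩, hxy, h⟩ := Finset.exists_ne_zero_of_sum_ne_zero hm
    rw [Finset.HasAntidiagonal.mem_antidiagonal] at hxy
    simp only at hxy
    rw [← hxy]
    apply key x y h
    rintro h2
    simp only [Prod.mk.injEq] at h2
    apply hne
    rw [← hxy, h2.1, h2.2]

theorem topAt_prod {n : ℕ} {ι : Type*} (s : Finset ι) (f : ι → MvPolynomial (Fin n) K1) (a : ι → Fin n →₀ ℕ)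
    (h : ∀ i ∈ s, TopAt (f i) (a i)) : TopAt (∏ i ∈ s, f i) (∑ i ∈ s, a i) := by
  induction s using Finset.induction_on with
  | empty => simpa using topAt_one
  | insert b s hb ih =>
    rw [Finset.sum_insert hb, Finset.prod_insert hb]
    exact topAt_mul (h b (Finset.mem_insert_self _ _)) (ih fun i hi => h i (Finset.mem_insert_of_mem hi))

theorem topAt_X {n : ℕ} (i : Fin n) (c : K1) : TopAt (X i - C c) (Finsupp.single i 1) := by
  have h0 : (0 : Fin n →₀ ℕ) ≠ Finsupp.single i 1 := by
    intro h
    have := DFunLike.congr_fun h i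
    simp at this
  constructor
  · rw [coeff_sub, coeff_C, if_neg h0, sub_zero, coeff_X, if_pos rfl]
  · intro m hm hne
    rw [coeff_sub, coeff_C, coeff_X, if_neg hne.symm] at hm
    have hm0 : 0 = m := by
      by_contra h
      simp [h] at hm
    rw [← hm0, wt_single]
    have : wt (0 : Fin n →₀ ℕ) = 0 := by simp [wt]
    have := i.2
    omega

/-- indicator exponent -/
def indE {n : ℕ} (S : Finset (Fin n)) : Fin n →₀ ℕ := ∑ i ∈ S, Finsupp.single i 1

theorem wt_indE {n : ℕ} (S : Finset (Fin n)) : wt (indE S) = ∑ i ∈ S, (n - (i : ℕ)) := by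
  induction S using Finset.induction_on with
  | empty => simp [indE, wt]
  | insert b s hb ih =>
    rw [indE, Finset.sum_insert hb, wt_add, Finset.sum_insert hb, ← indE, ih, wt_single]

/-- initial segment -/
def seg (n k : ℕ) : Finset (Fin n) := Finset.univ.filter (fun i => (i : ℕ) < k)

theorem card_seg {n k : ℕ} (hk : k ≤ n) : (seg n k).card = k := by
  simp [seg, Fin.card_filter_val_lt, hk]

theorem seg_lt {n k : ℕ} (hk : k ≤ n) (S : Finset (Fin n)) (hS : S.card = k) (hne : S ≠ seg n k) :
    wt (indE S) < wt (indE (seg n k)) := by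
  rw [wt_indE, wt_indE, ← Finset.sum_sdiff_lt_sum_sdiff]
  have hc : (S \ seg n k).card = (seg n k \ S).card := by
    apply Finset.card_sdiff_comm
    rw [hS, card_seg hk]
  have hpos : 0 < (S \ seg n k).card := by
    rw [Finset.card_pos, Finset.sdiff_nonempty]
    intro h
    exact hne (Finset.eq_of_subset_of_card_le h (by rw [hS, card_seg hk]))
  calc ∑ i ∈ S \ seg n k, (n - (i : ℕ)) ≤ (S \ seg n k).card • (n - k) := by
        apply Finset.sum_le_card_nsmul
        intro i hi
        simp [seg] at hi
        omega
    _ < (seg n k \ S).card • (n - k + 1) := by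
        rw [← hc]; simp only [smul_eq_mul]; exact Nat.mul_lt_mul_of_pos_left (by omega) hpos
    _ ≤ _ := by
        apply Finset.card_nsmul_le_sum
        intro i hi
        simp [seg] at hi
        omega

theorem topAt_estar {n k : ℕ} (hk : k ≤ n) : TopAt (estarElem1 n k) (indE (seg n k)) := by
  have hT : ∀ S : Finset (Fin n), TopAt (∏ i ∈ S,
      (X i - C (t1 ^ (Finset.univ.filter (fun j : Fin n => j < i ∧ j ∉ S)).card
        / t1 ^ (n - 1)) : MvPolynomial (Fin n) K1)) (indE S) := fun S =>
    topAt_prod S _ _ (fun i _ => topAt_X i _)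
  constructor
  · rw [estarElem1, coeff_sum, Finset.sum_eq_single (seg n k)]
    · exact (hT _).1
    · intro S hS hne
      rw [Finset.mem_powersetCard] at hS
      have h1 := seg_lt hk S hS.2 hne
      by_contra h
      by_cases h2 : indE (seg n k) = indE S
      · rw [h2] at h1; omega
      · have := (hT S).2 _ h h2
        omega
    · intro h
      exact absurd (Finset.mem_powersetCard.2 ⟨Finset.subset_univ _, card_seg hk⟩) h
  · intro m hm hne
    rw [estarElem1, coeff_sum] at hm
    obtain ⟨S, hS, h⟩ := Finset.exists_ne_zero_of_sum_ne_zero hm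
    rw [Finset.mem_powersetCard] at hS
    by_cases hS2 : S = seg n k
    · subst hS2
      exact (hT _).2 m h hne
    · have h1 := seg_lt hk S hS.2 hS2
      by_cases h2 : m = indE S
      · rw [h2]; exact h1
      · have := (hT S).2 _ h h2
        omega

theorem indE_apply {n : ℕ} (S : Finset (Fin n)) (r : Fin n) : indE S r = if r ∈ S then 1 else 0 := by
  rw [indE, Finsupp.finsetSum_apply]
  simp [Finsupp.single_apply]

theorem conj_le {n : ℕ} (l : Fin n → ℕ) (m : ℕ) : conjPart l m ≤ n := by
  have := Finset.card_le_univ (Finset.univ.filter (fun i : Fin n => m ≤ l i))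
  simpa [conjPart] using this

theorem lt_conj {n : ℕ} {l : Fin n → ℕ} (hl : IsPartition l) (r : Fin n) (m : ℕ) :
    (r : ℕ) < conjPart l m ↔ m ≤ l r := by
  constructor
  · intro h
    by_contra h2
    have : (Finset.univ.filter (fun i : Fin n => m ≤ l i)) ⊆ Finset.Iio r := by
      intro i hi
      rw [Finset.mem_filter] at hi
      rw [Finset.mem_Iio]
      by_contra h3
      have := hl r i (not_lt.1 h3)
      omega
    have := Finset.card_le_card this
    rw [Fin.card_Iio] at this
    rw [conjPart] at h
    omega
  · intro h
    have : Finset.Iic r ⊆ (Finset.univ.filter (fun i : Fin n => m ≤ l i)) := by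
      intro i hi
      rw [Finset.mem_Iic] at hi
      rw [Finset.mem_filter]
      have := hl i r hi
      exact ⟨Finset.mem_univ _, by omega⟩
    have := Finset.card_le_card this
    rw [Fin.card_Iic] at this
    rw [conjPart]
    omega

theorem sum_conj {n : ℕ} (hn : 1 ≤ n) {l : Fin n → ℕ} (hl : IsPartition l) (r : Fin n) :
    ∑ i ∈ Finset.range (l ⟨0, hn⟩), (if (r : ℕ) < conjPart l (i + 1) then 1 else 0) = l r := by
  have h0 : l r ≤ l ⟨0, hn⟩ := hl _ _ (Fin.le_def.2 (Nat.zero_le _))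
  simp only [lt_conj hl]
  rw [← Finset.card_filter]
  have : (Finset.range (l ⟨0, hn⟩)).filter (fun i => i + 1 ≤ l r) = Finset.range (l r) := by
    ext i
    simp only [Finset.mem_filter, Finset.mem_range]
    omega
  rw [this, Finset.card_range]

theorem coeff_top {n : ℕ} (hn : 1 ≤ n) {l : Fin n → ℕ} (hl : IsPartition l) :
    coeff (expOf l) (∏ i ∈ Finset.range (l ⟨0, hn⟩), estarElem1 n (conjPart l (i + 1))) = 1 := by
  have h := topAt_prod (Finset.range (l ⟨0, hn⟩)) (fun i => estarElem1 n (conjPart l (i + 1)))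
    (fun i => indE (seg n (conjPart l (i + 1)))) (fun i _ => topAt_estar (conj_le l _))
  have h2 : expOf l = ∑ i ∈ Finset.range (l ⟨0, hn⟩), indE (seg n (conjPart l (i + 1))) := by
    ext r
    rw [Finsupp.finsetSum_apply]
    simp only [indE_apply, seg, Finset.mem_filter, Finset.mem_univ, true_and]
    rw [sum_conj hn hl r]
    rfl
  rw [h2]
  exact h.1

theorem br_one (m : ℕ) : br (1 : K1) m = m := by simp [br]

theorem ceig_conj {n : ℕ} (hn : 1 ≤ n) {l : Fin n → ℕ} (hl : IsPartition l) :
    ceig 1 t1 l = ∑ i ∈ Finset.range (l ⟨0, hn⟩), ∑ r ∈ Finset.range (conjPart l (i + 1)), t1 ^ r := by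
  have h1 : ∀ i, ∑ r ∈ Finset.range (conjPart l (i + 1)), t1 ^ r =
      ∑ r : Fin n, t1 ^ (r : ℕ) * (if (r : ℕ) < conjPart l (i + 1) then 1 else 0 : ℕ) := by
    intro i
    rw [Fin.sum_univ_eq_sum_range (fun r => t1 ^ r * ((if r < conjPart l (i + 1) then 1 else 0 : ℕ) : K1))]
    rw [← Finset.sum_subset (Finset.range_subset_range.2 (conj_le l (i + 1)))]
    · apply Finset.sum_congr rfl
      intro r hr
      rw [if_pos (Finset.mem_range.1 hr)]; simp
    · intro r _ hr
      rw [if_neg (fun h => hr (Finset.mem_range.2 h))]; simp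
  simp only [h1]
  rw [Finset.sum_comm, ceig]
  apply Finset.sum_congr rfl
  intro r _
  rw [← Finset.mul_sum, ← Nat.cast_sum, sum_conj hn hl r, br_one]

theorem evec_add {n : ℕ} (a b : Fin n →₀ ℕ) : evec (a + b) = evec a * evec b := by
  simp [evec, pow_add, Finset.prod_mul_distrib]

theorem gam_add {n : ℕ} (a b : Fin n →₀ ℕ) : gam (a + b) = gam a + gam b := by
  simp [gam, add_mul, Finset.sum_add_distrib]

theorem evec_single {n : ℕ} (i : Fin n) : evec (Finsupp.single i 1) = estarElem1 n (i + 1) := by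
  rw [evec, Finset.prod_eq_single i]
  · simp
  · intro b _ hb
    simp [Finsupp.single_apply, hb.symm]
  · simp

theorem gam_single {n : ℕ} (i : Fin n) :
    gam (Finsupp.single i 1) = ∑ r ∈ Finset.range ((i : ℕ) + 1), t1 ^ r := by
  rw [gam, Finset.sum_eq_single i]
  · simp
  · intro b _ hb
    simp [Finsupp.single_apply, hb.symm]
  · simp

theorem exists_a {n : ℕ} (s : Finset ℕ) (k : ℕ → ℕ) (h : ∀ i ∈ s, 1 ≤ k i ∧ k i ≤ n) :
    ∃ a : Fin n →₀ ℕ, evec a = ∏ i ∈ s, estarElem1 n (k i) ∧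
      gam a = ∑ i ∈ s, ∑ r ∈ Finset.range (k i), t1 ^ r := by
  induction s using Finset.induction_on with
  | empty => exact ⟨0, by simp [evec], by simp [gam]⟩
  | insert b s hb ih =>
    obtain ⟨a, h1, h2⟩ := ih fun i hi => h i (Finset.mem_insert_of_mem hi)
    obtain ⟨h3, h4⟩ := h b (Finset.mem_insert_self _ _)
    have h5 : k b - 1 + 1 = k b := by omega
    refine ⟨Finsupp.single ⟨k b - 1, by omega⟩ 1 + a, ?_, ?_⟩
    · rw [evec_add, evec_single, Finset.prod_insert hb, h1]
      simp only [h5]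
    · rw [gam_add, gam_single, Finset.sum_insert hb, h2]
      simp only [h5]

theorem main_lemma {n : ℕ} (hn : 1 ≤ n) {l : Fin n → ℕ} (hl : IsPartition l)
    (f : MvPolynomial (Fin n) K) (hf : f.IsSymmetric) (hd : f.totalDegree ≤ csize l) (hf0 : f ≠ 0)
    (h : ∀ ν : Fin n → ℕ, IsPartition ν → csize ν ≤ csize l → ν ≠ l → eval (hp ν) f = 0) :
    coeff (expOf l) f ≠ 0 ∧ ∀ m, RegAtQ1 (coeff m f / coeff (expOf l) f)
      (coeff m (∏ i ∈ Finset.range (l ⟨0, hn⟩), estarElem1 n (conjPart l (i + 1)))) := by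
  obtain ⟨c, F, hc, hF, hF0⟩ := exists_reduction f hf0
  have hN : NN qq⁻¹ tt (tt⁻¹ ^ (n - 1)) (map phi F) = C (ceig qq⁻¹ tt l) * D2 K n * map phi F := by
    rw [hF, NN_smul, eigen_main l f hf hd h]; ring
  have hE := transfer F l hN
  have hFs : (map psi F).IsSymmetric := by
    intro σ
    rw [← map_rename]
    congr 1
    apply map_injective phi phi_inj
    rw [map_rename, hF, map_mul, rename_C, hf σ]
  obtain ⟨a, ha1, ha2⟩ := exists_a (n := n) (Finset.range (l ⟨0, hn⟩)) (fun i => conjPart l (i + 1)) (by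
    intro i hi
    refine ⟨?_, conj_le l _⟩
    exact (lt_conj hl ⟨0, hn⟩ (i + 1)).2 (Finset.mem_range.1 hi))
  rw [ceig_conj hn hl, ← ha2] at hE
  obtain ⟨κ, hκ⟩ := eig_unique _ hFs a hE
  rw [ha1] at hκ
  set v := ∏ i ∈ Finset.range (l ⟨0, hn⟩), estarElem1 n (conjPart l (i + 1)) with hv
  have hκ0 : κ ≠ 0 := by
    rintro rfl
    apply hF0
    rw [hκ, C_0, zero_mul]
  have hpsi : ∀ m, psi (coeff m F) = κ * coeff m v := by
    intro m
    rw [← coeff_map, hκ, coeff_C_mul]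
  have hphi : ∀ m, phi (coeff m F) = c * coeff m f := by
    intro m
    rw [← coeff_map, hF, coeff_C_mul]
  have hreg : ∀ m, RegAtQ1 (c * coeff m f) (κ * coeff m v) := by
    intro m
    rw [← hpsi, ← hphi]
    exact reg_phi_psi _
  have htop : coeff (expOf l) v = 1 := coeff_top hn hl
  have hl0 : coeff (expOf l) f ≠ 0 := by
    intro h0
    have h1 := hphi (expOf l)
    rw [h0, mul_zero] at h1
    have h2 : coeff (expOf l) F = 0 := phi_inj (by rw [h1, map_zero])
    have h3 := hpsi (expOf l)
    rw [h2, map_zero, htop, mul_one] at h3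
    exact hκ0 h3.symm
  refine ⟨hl0, fun m => ?_⟩
  have hi := reg_inv (hreg (expOf l)) (by rw [htop, mul_one]; exact hκ0)
  have := reg_mul (hreg m) hi
  rw [htop, mul_one] at this
  convert this using 1
  · field_simp
  · field_simp

theorem pstar_spec {n : ℕ} (hn : 1 ≤ n) {l : Fin n → ℕ} (hl : IsPartition l) : IsPstar l (Pstar l) := by
  have hex : ∃ f : MvPolynomial (Fin n) K, IsPstar l f := by
    obtain ⟨f, hf, hd, hf0, h⟩ := exists_interp l hl
    obtain ⟨hl0, -⟩ := main_lemma hn hl f hf hd hf0 h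
    have hs : (C (coeff (expOf l) f)⁻¹ * f).IsSymmetric := by
      intro σ
      rw [map_mul, rename_C, hf σ]
    refine ⟨C (coeff (expOf l) f)⁻¹ * f, hs, ?_, ?_, ?_⟩
    · rw [C_mul']
      exact (totalDegree_smul_le _ _).trans hd
    · rw [coeff_C_mul, inv_mul_cancel₀ hl0]
    · intro ν hν hs1 hne
      rw [evalPt_eq ν hν hs, map_mul, h ν hν hs1 hne, mul_zero]
  rw [Pstar, dif_pos hex]
  exact hex.choose_spec

theorem final (n : ℕ) (hn : 1 ≤ n) (l : Fin n → ℕ) (hl : IsPartition l) :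
    ∃ g : MvPolynomial (Fin n) K1,
      (∀ m : Fin n →₀ ℕ, RegAtQ1 (coeff m (Pstar l)) (coeff m g)) ∧
      g = ∏ i ∈ Finset.range (l ⟨0, hn⟩), estarElem1 n (conjPart l (i + 1)) := by
  refine ⟨_, ?_, rfl⟩
  obtain ⟨hs, hd, h1, h⟩ := pstar_spec hn hl
  have h0 : Pstar l ≠ 0 := by
    intro h0
    rw [h0, coeff_zero] at h1
    exact zero_ne_one h1
  intro m
  have := (main_lemma hn hl (Pstar l) hs hd h0 (fun ν hν hs1 hne => by
    rw [← evalPt_eq ν hν hs]; exact h ν hν hs1 hne)).2 m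
  rwa [h1, div_one] at this

/-- factorization of the interpolation Macdonald polynomial at `q = 1`. -/
theorem statement18 (n : ℕ) (hn : 1 ≤ n) (l : Fin n → ℕ) (hl : IsPartition l) :
    ∃ g : MvPolynomial (Fin n) K1,
      (∀ m : Fin n →₀ ℕ, RegAtQ1 (coeff m (Pstar l)) (coeff m g)) ∧
      g = ∏ i ∈ Finset.range (l ⟨0, hn⟩), estarElem1 n (conjPart l (i + 1)) := by
  exact final n hn l hl
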